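/- arXiv:2108.09244 — 3 statements merged into one kernel-verified Lean document; each statement's English description precedes it below -/
import Mathlib

section
/- For every ν ∈ (0,2], the function z ↦ (H_{−ν}(√z))² / H_{−2ν}(√z) is logarithmically completely monotone on (0,∞), i.e. the function z ↦ −(d/dz) log((H_{−ν}(√z))² / H_{−2ν}(√z)) is completely monotone on (0,∞). -/
open MeasureTheory Set

/-- The Hermite function of negative order: `H_{-ν}(z)` for `ν > 0`. -/
noncomputable def HermiteNeg (ν z : ℝ) : ℝ :=
  (1 / Real.Gamma ν) * ∫ t in Ioi (0 : ℝ), Real.exp (-t ^ 2 - 2 * t * z) * t ^ (ν - 1)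

/-- The unnormalised integral `Γ(ν) H_{-ν}(ζ)` at a complex argument. -/
noncomputable def hermiteIntegral (ν : ℝ) (ζ : ℂ) : ℂ :=
  ∫ t in Ioi (0 : ℝ), Complex.exp (-(t : ℂ) ^ 2 - 2 * t * ζ) * ((t ^ (ν - 1) : ℝ) : ℂ)

lemma integrableOn_exp_quadratic_mul_rpow {ν : ℝ} (hν : 0 < ν) (c : ℝ) :
    IntegrableOn (fun t : ℝ => Real.exp (-t ^ 2 + c * t) * t ^ (ν - 1)) (Ioi 0) := by
  have h := (integrableOn_rpow_mul_exp_neg_mul_sq (b := 1 / 2) (by norm_num)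
    (s := ν - 1) (by linarith)).const_mul (Real.exp (c ^ 2 / 2))
  refine Integrable.mono' h (by fun_prop) ?_
  filter_upwards [ae_restrict_mem measurableSet_Ioi] with t ht
  have ht' : 0 ≤ t ^ (ν - 1) := Real.rpow_nonneg (le_of_lt ht) _
  rw [Real.norm_of_nonneg (by positivity), mul_left_comm, ← Real.exp_add, mul_comm]
  refine mul_le_mul_of_nonneg_left (Real.exp_le_exp.2 ?_) ht'
  nlinarith [sq_nonneg (t - c)]

lemma norm_hermiteIntegrand (ν : ℝ) (ζ : ℂ) {t : ℝ} (ht : 0 < t) :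
    ‖Complex.exp (-(t : ℂ) ^ 2 - 2 * t * ζ) * ((t ^ (ν - 1) : ℝ) : ℂ)‖ =
      Real.exp (-t ^ 2 + (-2 * ζ.re) * t) * t ^ (ν - 1) := by
  rw [norm_mul, Complex.norm_exp, Complex.norm_real,
    Real.norm_of_nonneg (Real.rpow_nonneg ht.le _)]
  congr 2
  simp [pow_two]
  ring

lemma integrableOn_hermiteIntegrand {ν : ℝ} (hν : 0 < ν) (ζ : ℂ) :
    IntegrableOn (fun t : ℝ => Complex.exp (-(t : ℂ) ^ 2 - 2 * t * ζ) *
      ((t ^ (ν - 1) : ℝ) : ℂ)) (Ioi 0) := by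
  refine Integrable.mono' (integrableOn_exp_quadratic_mul_rpow hν (-2 * ζ.re)) (by fun_prop) ?_
  filter_upwards [ae_restrict_mem measurableSet_Ioi] with t ht
  exact (norm_hermiteIntegrand ν ζ ht).le

lemma mul_rpow_sub_one {t : ℝ} (ht : 0 < t) (ν : ℝ) : t * t ^ (ν - 1) = t ^ ν := by
  rw [Real.rpow_sub_one ht.ne', mul_div_cancel₀ _ ht.ne']

lemma hasDerivAt_hermiteIntegral {ν : ℝ} (hν : 0 < ν) (ζ : ℂ) :
    HasDerivAt (hermiteIntegral ν) (-2 * hermiteIntegral (ν + 1) ζ) ζ := by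
  have hmeas : ∀ (μ : ℝ) (ξ : ℂ), AEStronglyMeasurable (fun t : ℝ =>
      Complex.exp (-(t : ℂ) ^ 2 - 2 * t * ξ) * ((t ^ (μ - 1) : ℝ) : ℂ))
      (volume.restrict (Ioi 0)) := fun μ ξ => by fun_prop
  have key := (hasDerivAt_integral_of_dominated_loc_of_deriv_le (μ := volume.restrict (Ioi 0))
    (F := fun ξ (t : ℝ) => Complex.exp (-(t : ℂ) ^ 2 - 2 * t * ξ) * ((t ^ (ν - 1) : ℝ) : ℂ))
    (F' := fun ξ (t : ℝ) => -2 * (Complex.exp (-(t : ℂ) ^ 2 - 2 * t * ξ) *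
      ((t ^ (ν + 1 - 1) : ℝ) : ℂ)))
    (bound := fun t => 2 * (Real.exp (-t ^ 2 + (2 * (‖ζ‖ + 1)) * t) * t ^ (ν + 1 - 1)))
    (x₀ := ζ) (Metric.ball_mem_nhds ζ one_pos) (.of_forall fun ξ => hmeas ν ξ)
    (integrableOn_hermiteIntegrand hν ζ) ((hmeas (ν + 1) ζ).const_mul _) ?_
    ((integrableOn_exp_quadratic_mul_rpow (by linarith) _).const_mul _) ?_).2
  · rw [integral_const_mul] at key
    exact key
  · filter_upwards [ae_restrict_mem measurableSet_Ioi] with t ht ξ hξ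
    rw [norm_mul, norm_hermiteIntegrand _ _ ht]
    have h1 : -ξ.re ≤ ‖ζ‖ + 1 := by
      have h2 := (abs_le.1 (Complex.abs_re_le_norm ξ)).1
      have h3 := norm_le_norm_add_norm_sub' ξ ζ
      rw [Metric.mem_ball, dist_eq_norm] at hξ
      linarith
    have ht' : (0 : ℝ) < t := ht
    simp only [norm_neg, Complex.norm_ofNat]
    refine mul_le_mul_of_nonneg_left (mul_le_mul_of_nonneg_right (Real.exp_le_exp.2 ?_)
      (Real.rpow_nonneg ht'.le _)) zero_le_two
    nlinarith
  · filter_upwards [ae_restrict_mem measurableSet_Ioi] with t ht ξ _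
    have ht' : (0 : ℝ) < t := ht
    have h1 : HasDerivAt (fun ξ : ℂ => -(t : ℂ) ^ 2 - 2 * t * ξ) (-(2 * (t : ℂ))) ξ := by
      simpa using HasDerivAt.const_sub (-(t : ℂ) ^ 2) ((hasDerivAt_id ξ).const_mul (2 * (t : ℂ)))
    have h2 := h1.cexp.mul_const ((t ^ (ν - 1) : ℝ) : ℂ)
    refine h2.congr_deriv ?_
    rw [add_sub_cancel_right, ← mul_rpow_sub_one ht' ν]
    push_cast
    ring

lemma hermiteIntegral_recurrence {ν : ℝ} (hν : 0 < ν) (ζ : ℂ) :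
    ν * hermiteIntegral ν ζ =
      2 * ζ * hermiteIntegral (ν + 1) ζ + 2 * hermiteIntegral (ν + 2) ζ := by
  have i0 := integrableOn_hermiteIntegrand hν ζ
  have i1 := integrableOn_hermiteIntegrand (ν := ν + 1) (by linarith) ζ
  have i2 := integrableOn_hermiteIntegrand (ν := ν + 2) (by linarith) ζ
  have hd : ∀ t ∈ Ioi (0 : ℝ), HasDerivAt
      (fun t : ℝ => Complex.exp (-(t : ℂ) ^ 2 - 2 * t * ζ) * ((t ^ (ν + 1 - 1) : ℝ) : ℂ))
      (ν * (Complex.exp (-(t : ℂ) ^ 2 - 2 * t * ζ) * ((t ^ (ν - 1) : ℝ) : ℂ))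
        - 2 * ζ * (Complex.exp (-(t : ℂ) ^ 2 - 2 * t * ζ) * ((t ^ (ν + 1 - 1) : ℝ) : ℂ))
        - 2 * (Complex.exp (-(t : ℂ) ^ 2 - 2 * t * ζ) * ((t ^ (ν + 2 - 1) : ℝ) : ℂ))) t := by
    intro t ht
    have ht' : (0 : ℝ) < t := ht
    have h0 : HasDerivAt (fun t : ℝ => (t : ℂ)) 1 t := Complex.ofRealCLM.hasDerivAt
    have h1 : HasDerivAt (fun t : ℝ => -(t : ℂ) ^ 2 - 2 * t * ζ) (-(2 * t) - 2 * ζ) t := by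
      have h := (h0.pow 2).neg.sub ((h0.const_mul 2).mul_const ζ)
      simpa using! h
    have h2 : HasDerivAt (fun t : ℝ => ((t ^ (ν + 1 - 1) : ℝ) : ℂ))
        ((ν * t ^ (ν - 1) : ℝ) : ℂ) t := by
      simp only [add_sub_cancel_right]
      exact (Real.hasDerivAt_rpow_const (Or.inl ht'.ne')).ofReal_comp
    refine (h1.cexp.mul h2).congr_deriv ?_
    rw [show ν + 2 - 1 = ν + 1 by ring, show ν + 1 - 1 = ν by ring,
      ← mul_rpow_sub_one ht' (ν + 1), show ν + 1 - 1 = ν by ring]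
    push_cast
    ring
  have hi' : IntegrableOn (fun t : ℝ =>
      ν * (Complex.exp (-(t : ℂ) ^ 2 - 2 * t * ζ) * ((t ^ (ν - 1) : ℝ) : ℂ))
        - 2 * ζ * (Complex.exp (-(t : ℂ) ^ 2 - 2 * t * ζ) * ((t ^ (ν + 1 - 1) : ℝ) : ℂ)))
      (Ioi 0) := (i0.const_mul (ν : ℂ)).sub (i1.const_mul (2 * ζ))
  have hi := hi'.sub (i2.const_mul 2)
  have h := integral_Ioi_of_hasDerivAt_of_tendsto (a := (0 : ℝ)) ?_ hd hi
    (tendsto_zero_of_hasDerivAt_of_integrableOn_Ioi hd hi i1)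
  · rw [integral_sub hi' (i2.const_mul 2),
      integral_sub (i0.const_mul (ν : ℂ)) (i1.const_mul (2 * ζ)), integral_const_mul,
      integral_const_mul, integral_const_mul] at h
    simp only [add_sub_cancel_right, Complex.ofReal_zero, Real.zero_rpow hν.ne', mul_zero,
      sub_zero] at h
    simp only [hermiteIntegral, add_sub_cancel_right]
    linear_combination h
  · refine ContinuousAt.continuousWithinAt (ContinuousAt.mul (by fun_prop) ?_)
    exact Complex.continuous_ofReal.continuousAt.comp
      (Real.continuousAt_rpow_const _ _ (Or.inr (by linarith)))

lemma hermiteIntegral_ofReal (ν x : ℝ) :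
    hermiteIntegral ν x =
      ((∫ t in Ioi (0 : ℝ), Real.exp (-t ^ 2 - 2 * t * x) * t ^ (ν - 1) : ℝ) : ℂ) := by
  rw [hermiteIntegral, ← integral_complex_ofReal]
  push_cast
  rfl

lemma hermiteIntegral_ofReal_re_pos {ν : ℝ} (hν : 0 < ν) (x : ℝ) :
    0 < (hermiteIntegral ν x).re := by
  rw [hermiteIntegral_ofReal, Complex.ofReal_re]
  have hi := integrableOn_exp_quadratic_mul_rpow hν (-2 * x)
  refine (setIntegral_pos_iff_support_of_nonneg_ae ?_ ?_).2 ?_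
  · filter_upwards [ae_restrict_mem measurableSet_Ioi] with t ht
    have : 0 ≤ t ^ (ν - 1) := Real.rpow_nonneg (le_of_lt ht) _
    simp only [Pi.zero_apply]
    positivity
  · refine hi.congr_fun (fun t _ => ?_) measurableSet_Ioi
    simp only
    congr 2
    ring
  · refine lt_of_lt_of_le (b := volume (Ioi (0 : ℝ))) (by simp) (measure_mono fun t ht => ?_)
    refine ⟨?_, ht⟩
    have := Real.rpow_pos_of_pos (mem_Ioi.1 ht) (ν - 1)
    simp only [Function.mem_support]
    positivity

lemma hermiteIntegral_ofReal_eq_re (ν x : ℝ) :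
    hermiteIntegral ν x = ((hermiteIntegral ν x).re : ℂ) := by
  rw [hermiteIntegral_ofReal, Complex.ofReal_re]

lemma integral_exp_neg_sq_tendsto_atTop :
    Filter.Tendsto (fun y : ℝ => ∫ s in (0 : ℝ)..y, Real.exp (-s ^ 2)) Filter.atTop
      (nhds (√Real.pi / 2)) := by
  have h := intervalIntegral_tendsto_integral_Ioi (0 : ℝ)
    (integrable_exp_neg_mul_sq (b := 1) one_pos).integrableOn Filter.tendsto_id
  rw [integral_gaussian_Ioi] at h
  simpa using h

lemma integral_exp_neg_sq_tendsto_atBot :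
    Filter.Tendsto (fun y : ℝ => ∫ s in (0 : ℝ)..y, Real.exp (-s ^ 2)) Filter.atBot
      (nhds (-(√Real.pi / 2))) := by
  refine ((integral_exp_neg_sq_tendsto_atTop.comp Filter.tendsto_neg_atBot_atTop).neg).congr
    fun y => ?_
  have h := intervalIntegral.integral_comp_neg (a := 0) (b := y) fun s : ℝ => Real.exp (-s ^ 2)
  simp only [neg_sq, neg_zero] at h
  rw [Function.comp_apply, h, intervalIntegral.integral_symm, neg_neg]

lemma integrableOn_exp_neg_sq_sub_inv_sq (x : ℝ) {v : ℝ} (hv : 0 < v) :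
    IntegrableOn (fun u : ℝ => Real.exp (-(u ^ 2 * v ^ 2) - x ^ 2 / u ^ 2)) (Ioi 0) := by
  refine Integrable.mono' (integrable_exp_neg_mul_sq (b := v ^ 2) (by positivity)).integrableOn
    (Measurable.aestronglyMeasurable (by fun_prop)) (.of_forall fun u => ?_)
  rw [Real.norm_of_nonneg (by positivity)]
  refine Real.exp_le_exp.2 ?_
  have : 0 ≤ x ^ 2 / u ^ 2 := by positivity
  linarith

/-- The Cauchy–Schlömilch evaluation of `∫ exp (-(u v)² - (x / u)²) du`. -/
lemma integral_exp_neg_sq_sub_inv_sq {x v : ℝ} (hx : 0 ≤ x) (hv : 0 < v) :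
    ∫ u in Ioi (0 : ℝ), Real.exp (-(u ^ 2 * v ^ 2) - x ^ 2 / u ^ 2) =
      √Real.pi / 2 * (Real.exp (-2 * x * v) / v) := by
  rcases hx.eq_or_lt with rfl | hx
  · have h := integral_gaussian_Ioi (v ^ 2)
    rw [Real.sqrt_div' _ (by positivity), Real.sqrt_sq hv.le] at h
    simp only [ne_eq, OfNat.ofNat_ne_zero, not_false_eq_true, zero_pow, zero_div, sub_zero,
      mul_zero, zero_mul, Real.exp_zero]
    rw [← mul_div_assoc, mul_one, div_right_comm, ← h]
    congr 1 with u
    ring_nf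
  set E : ℝ → ℝ := fun y => ∫ s in (0 : ℝ)..y, Real.exp (-s ^ 2) with hE
  have hEd : ∀ y, HasDerivAt E (Real.exp (-y ^ 2)) y := fun y =>
    intervalIntegral.integral_hasDerivAt_right (Continuous.intervalIntegrable (by fun_prop) _ _)
      (Continuous.stronglyMeasurableAtFilter (by fun_prop) _ _) (by fun_prop)
  set Φ : ℝ → ℝ := fun u => (1 / (2 * v)) * (Real.exp (-2 * x * v) * E (u * v - x * u⁻¹) +
    Real.exp (2 * x * v) * E (u * v + x * u⁻¹)) with hΦ
  have hΦd : ∀ u ∈ Ioi (0 : ℝ),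
      HasDerivAt Φ (Real.exp (-(u ^ 2 * v ^ 2) - x ^ 2 / u ^ 2)) u := by
    intro u hu
    have hu : 0 < u := hu
    have h1 : HasDerivAt (fun u : ℝ => u * v - x * u⁻¹) (v + x / u ^ 2) u := by
      have h := ((hasDerivAt_id u).mul_const v).sub ((hasDerivAt_inv hu.ne').const_mul x)
      refine h.congr_deriv ?_
      ring
    have h2 : HasDerivAt (fun u : ℝ => u * v + x * u⁻¹) (v - x / u ^ 2) u := by
      have h := ((hasDerivAt_id u).mul_const v).add ((hasDerivAt_inv hu.ne').const_mul x)
      refine h.congr_deriv ?_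
      ring
    have h3 := ((((hEd _).comp u h1).const_mul (Real.exp (-2 * x * v))).add
      (((hEd _).comp u h2).const_mul (Real.exp (2 * x * v)))).const_mul (1 / (2 * v))
    refine h3.congr_deriv ?_
    rw [← mul_assoc, ← mul_assoc, ← Real.exp_add, ← Real.exp_add]
    have e1 : -2 * x * v + -(u * v - x * u⁻¹) ^ 2 = -(u ^ 2 * v ^ 2) - x ^ 2 / u ^ 2 := by
      field_simp; ring
    have e2 : 2 * x * v + -(u * v + x * u⁻¹) ^ 2 = -(u ^ 2 * v ^ 2) - x ^ 2 / u ^ 2 := by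
      field_simp; ring
    rw [e1, e2]
    field_simp
    ring
  have hlin : Filter.Tendsto (fun u : ℝ => u * v) Filter.atTop Filter.atTop :=
    Filter.tendsto_id.atTop_mul_const hv
  have hinv : Filter.Tendsto (fun u : ℝ => x * u⁻¹) Filter.atTop (nhds 0) := by
    simpa using (tendsto_inv_atTop_zero (𝕜 := ℝ)).const_mul x
  have hlin0 : Filter.Tendsto (fun u : ℝ => u * v) (nhdsWithin 0 (Ioi 0)) (nhds 0) := by
    have : ContinuousAt (fun u : ℝ => u * v) 0 := by fun_prop
    simpa [ContinuousAt] using this.tendsto.mono_left nhdsWithin_le_nhds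
  have hinv0 : Filter.Tendsto (fun u : ℝ => x * u⁻¹) (nhdsWithin 0 (Ioi 0)) Filter.atTop :=
    tendsto_inv_nhdsGT_zero.const_mul_atTop hx
  have hneg : Filter.Tendsto (fun u : ℝ => u * v - x * u⁻¹) (nhdsWithin 0 (Ioi 0))
      Filter.atBot := by
    simpa [sub_eq_add_neg] using hlin0.add_atBot (Filter.tendsto_neg_atTop_atBot.comp hinv0)
  have hpos : Filter.Tendsto (fun u : ℝ => u * v - x * u⁻¹) Filter.atTop Filter.atTop := by
    simpa [sub_eq_add_neg] using hlin.atTop_add hinv.neg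
  have htop : Filter.Tendsto Φ Filter.atTop (nhds ((1 / (2 * v)) *
      (Real.exp (-2 * x * v) * (√Real.pi / 2) + Real.exp (2 * x * v) * (√Real.pi / 2)))) :=
    (((integral_exp_neg_sq_tendsto_atTop.comp hpos).const_mul _).add
      ((integral_exp_neg_sq_tendsto_atTop.comp (hlin.atTop_add hinv)).const_mul _)).const_mul _
  have hzero : Filter.Tendsto Φ (nhdsWithin 0 (Ioi 0)) (nhds ((1 / (2 * v)) *
      (Real.exp (-2 * x * v) * (-(√Real.pi / 2)) + Real.exp (2 * x * v) * (√Real.pi / 2)))) :=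
    (((integral_exp_neg_sq_tendsto_atBot.comp hneg).const_mul _).add
      ((integral_exp_neg_sq_tendsto_atTop.comp (hlin0.add_atTop hinv0)).const_mul _)).const_mul _
  set L := (1 / (2 * v)) *
      (Real.exp (-2 * x * v) * (-(√Real.pi / 2)) + Real.exp (2 * x * v) * (√Real.pi / 2))
  have hupd : ∀ u ∈ Ioi (0 : ℝ), Function.update Φ 0 L u = Φ u := fun u hu =>
    Function.update_of_ne (ne_of_gt hu) _ _
  rw [integral_Ioi_of_hasDerivAt_of_tendsto (f := Function.update Φ 0 L) ?_ ?_
    (integrableOn_exp_neg_sq_sub_inv_sq x hv) (htop.congr' ?_), Function.update_self]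
  · simp only [L]
    field_simp
    ring
  · rw [continuousWithinAt_update_same, Ici_sdiff_left]
    exact hzero
  · intro u hu
    refine (hΦd u hu).congr_of_eventuallyEq ?_
    filter_upwards [isOpen_Ioi.mem_nhds hu] with w hw using hupd w hw
  · filter_upwards [Filter.eventually_gt_atTop 0] with u hu using (hupd u hu).symm

/-- Change of variables `(t, r) ↦ (t r, t - r)` on the open quadrant. -/
lemma setIntegral_comp_mul_sub (g : ℝ × ℝ → ℂ) :
    ∫ q in Ioi (0 : ℝ) ×ˢ (univ : Set ℝ), g q =
      ∫ q in Ioi (0 : ℝ) ×ˢ Ioi (0 : ℝ), (q.1 + q.2) • g (q.1 * q.2, q.1 - q.2) := by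
  set f : ℝ × ℝ → ℝ × ℝ := fun q => (q.1 * q.2, q.1 - q.2) with hf
  set f' : ℝ × ℝ → ℝ × ℝ →L[ℝ] ℝ × ℝ := fun q =>
    (Matrix.toLin (.finTwoProd ℝ) (.finTwoProd ℝ)
      !![q.2, q.1; 1, -1]).toContinuousLinearMap with hf'
  have himage : f '' (Ioi (0 : ℝ) ×ˢ Ioi (0 : ℝ)) = Ioi (0 : ℝ) ×ˢ univ := by
    ext ⟨p, w⟩
    simp only [mem_image, mem_prod, mem_Ioi, mem_univ, and_true, hf, Prod.mk.injEq, Prod.exists]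
    constructor
    · rintro ⟨t, r, ⟨ht, hr⟩, rfl, -⟩
      positivity
    · intro hp
      have h1 : √(w ^ 2 + 4 * p) ^ 2 = w ^ 2 + 4 * p := Real.sq_sqrt (by positivity)
      have h2 : |w| < √(w ^ 2 + 4 * p) := by
        rw [← Real.sqrt_sq_eq_abs]
        exact Real.sqrt_lt_sqrt (by positivity) (by linarith)
      have h3 := abs_lt.1 h2
      refine ⟨(√(w ^ 2 + 4 * p) + w) / 2, (√(w ^ 2 + 4 * p) - w) / 2,
        ⟨by linarith, by linarith⟩, by nlinarith, by ring⟩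
  have hinj : InjOn f (Ioi (0 : ℝ) ×ˢ Ioi (0 : ℝ)) := by
    rintro ⟨t, r⟩ ⟨ht, hr⟩ ⟨t', r'⟩ ⟨ht', hr'⟩ h
    simp only [hf, Prod.mk.injEq, mem_Ioi] at h ht hr ht' hr' ⊢
    have h1 : (t + r - (t' + r')) * (t + r + (t' + r')) = 0 := by
      linear_combination 4 * h.1 + (t - r + (t' - r')) * h.2
    have h2 : t + r - (t' + r') = 0 :=
      (mul_eq_zero.1 h1).resolve_right (by positivity)
    constructor <;> linarith [h.2]
  have hderiv : ∀ q ∈ Ioi (0 : ℝ) ×ˢ Ioi (0 : ℝ),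
      HasFDerivWithinAt f (f' q) (Ioi (0 : ℝ) ×ˢ Ioi (0 : ℝ)) q := by
    intro q _
    refine HasFDerivAt.hasFDerivWithinAt ?_
    simp only [hf']
    rw [Matrix.toLin_finTwoProd_toContinuousLinearMap]
    convert! HasFDerivAt.prodMk (𝕜 := ℝ)
      ((hasFDerivAt_fst (𝕜 := ℝ) (p := q)).mul (hasFDerivAt_snd (𝕜 := ℝ) (p := q)))
      ((hasFDerivAt_fst (𝕜 := ℝ) (p := q)).sub (hasFDerivAt_snd (𝕜 := ℝ) (p := q))) using 2
    · simp [add_comm]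
    · ext <;> simp
  rw [← himage, integral_image_eq_integral_abs_det_fderiv_smul volume
    (measurableSet_Ioi.prod measurableSet_Ioi) hderiv hinj]
  refine setIntegral_congr_fun (measurableSet_Ioi.prod measurableSet_Ioi) ?_
  rintro ⟨t, r⟩ ⟨ht, hr⟩
  simp only [mem_Ioi] at ht hr
  have hdet : (f' (t, r)).det = -(t + r) := by
    simp only [hf', LinearMap.det_toContinuousLinearMap, LinearMap.det_toLin,
      Matrix.det_fin_two_of]
    ring
  simp only [hdet, abs_neg, abs_of_pos (add_pos ht hr), hf]

lemma integral_univ_inv_sq_add_sq {x : ℝ} (hx : 0 < x) :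
    Integrable (fun s : ℝ => (x ^ 2 + s ^ 2)⁻¹) ∧
      ∫ s : ℝ, (x ^ 2 + s ^ 2)⁻¹ = Real.pi / x := by
  have h : ∀ s : ℝ, (x ^ 2 + s ^ 2)⁻¹ = (x ^ 2)⁻¹ * (1 + (x⁻¹ * s) ^ 2)⁻¹ := fun s => by
    field_simp
  simp_rw [h]
  refine ⟨(integrable_inv_one_add_sq.comp_mul_left' (inv_ne_zero hx.ne')).const_mul _, ?_⟩
  rw [integral_const_mul, Measure.integral_comp_mul_left (fun s => (1 + s ^ 2)⁻¹),
    integral_univ_inv_one_add_sq, inv_inv, abs_of_pos hx, smul_eq_mul]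
  field_simp

/-- The Poisson formula on the right half-plane, at a point of the positive real axis. -/
lemma poisson_rightHalfPlane {R : ℂ → ℂ} {C : ℝ}
    (hR : ∀ ζ : ℂ, 0 ≤ ζ.re → DifferentiableAt ℂ R ζ) (hC : ∀ ζ : ℂ, 0 ≤ ζ.re → ‖R ζ‖ ≤ C)
    {x : ℝ} (hx : 0 < x) :
    Integrable (fun s : ℝ => R (s * Complex.I) / ((x ^ 2 + s ^ 2 : ℝ) : ℂ)) ∧
      ∫ s : ℝ, R (s * Complex.I) / ((x ^ 2 + s ^ 2 : ℝ) : ℂ) = R x * (Real.pi / x) := by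
  obtain ⟨hi, hv⟩ := integral_univ_inv_sq_add_sq hx
  have hre : ∀ s : ℝ, ((s : ℂ) * Complex.I).re = 0 := fun s => by simp
  have hcont : Continuous fun s : ℝ => R (s * Complex.I) := by
    refine continuous_iff_continuousAt.2 fun s => ?_
    exact (hR _ (hre s).ge).continuousAt.comp (f := fun s : ℝ => (s : ℂ) * Complex.I)
      (by fun_prop)
  have hpos : ∀ s : ℝ, 0 < x ^ 2 + s ^ 2 := fun s => by positivity
  have hRint : Integrable (fun s : ℝ => R (s * Complex.I) / ((x ^ 2 + s ^ 2 : ℝ) : ℂ)) := by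
    refine Integrable.mono' (hi.const_mul C) ?_ (.of_forall fun s => ?_)
    · refine (hcont.div (by fun_prop) fun s => ?_).aestronglyMeasurable
      exact_mod_cast (hpos s).ne'
    · rw [norm_div, Complex.norm_real, Real.norm_of_nonneg (hpos s).le, div_eq_mul_inv]
      have := hpos s
      gcongr
      exact hC _ (hre s).ge
  refine ⟨hRint, ?_⟩
  set G : ℂ → ℂ := fun ζ => dslope R x ζ / (x + ζ) with hG
  have hGeq : ∀ ζ : ℂ, ζ ≠ x → G ζ = (R ζ - R x) / (ζ ^ 2 - x ^ 2) := fun ζ hζ => by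
    have h1 : ζ - x ≠ 0 := sub_ne_zero.2 hζ
    simp only [hG]
    rw [dslope_of_ne _ hζ, slope_def_field, div_div]
    congr 1
    ring
  have hGd : DifferentiableOn ℂ G {ζ | 0 ≤ ζ.re} := by
    refine DifferentiableOn.div ?_ (by fun_prop) fun ζ hζ h0 => ?_
    · refine (Complex.differentiableOn_dslope ?_).2
        fun ζ hζ => (hR ζ hζ).differentiableWithinAt
      filter_upwards [(isOpen_lt continuous_const Complex.continuous_re).mem_nhds
        (show (0 : ℝ) < (x : ℂ).re by simpa using hx)] with ζ hζ using le_of_lt hζ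
    · have h1 := congrArg Complex.re h0
      simp only [Complex.add_re, Complex.ofReal_re, Complex.zero_re, mem_ofPred_eq] at h1 hζ
      linarith
  have hGI : ∀ s : ℝ, G (s * Complex.I) =
      R x * (((x ^ 2 + s ^ 2)⁻¹ : ℝ) : ℂ) - R (s * Complex.I) / ((x ^ 2 + s ^ 2 : ℝ) : ℂ) := by
    intro s
    have h1 : ((x ^ 2 + s ^ 2 : ℝ) : ℂ) ≠ 0 := by exact_mod_cast (hpos s).ne'
    have h3 : (s * Complex.I : ℂ) ^ 2 - x ^ 2 = -((x ^ 2 + s ^ 2 : ℝ) : ℂ) := by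
      rw [mul_pow, Complex.I_sq]; push_cast; ring
    rw [hGeq _ fun h => by simpa [hx.ne] using congrArg Complex.re h, h3, Complex.ofReal_inv]
    field_simp
    ring
  have hb : ∀ T : ℝ, x < T → ∀ ζ : ℂ, 0 ≤ ζ.re → T ≤ ‖ζ‖ → ‖G ζ‖ ≤ 2 * C / (T ^ 2 - x ^ 2) := by
    intro T hT ζ hζ hTζ
    have hne : ζ ≠ x := by
      rintro rfl
      rw [Complex.norm_real, Real.norm_of_nonneg hx.le] at hTζ
      linarith
    have h1 : T ^ 2 - x ^ 2 ≤ ‖ζ ^ 2 - (x : ℂ) ^ 2‖ := by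
      have := norm_sub_norm_le (ζ ^ 2) ((x : ℂ) ^ 2)
      rw [norm_pow, norm_pow, Complex.norm_real, Real.norm_of_nonneg hx.le] at this
      have h2 : T ^ 2 ≤ ‖ζ‖ ^ 2 := by gcongr; linarith
      linarith
    have h2 : 0 < T ^ 2 - x ^ 2 := by nlinarith
    rw [hGeq ζ hne, norm_div]
    have h3 : ‖R ζ - R x‖ ≤ 2 * C := by
      have := norm_sub_le (R ζ) (R x)
      have := hC ζ hζ
      have := hC x (by simpa using hx.le)
      linarith
    have h4 := (norm_nonneg _).trans h3
    gcongr
  have hbound : ∀ T : ℝ, x < T →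
      ‖∫ s in (-T)..T, G (s * Complex.I)‖ ≤ 8 * C * (T / (T ^ 2 - x ^ 2)) := by
    intro T hT
    have hT0 : 0 < T := hx.trans hT
    have hrect := Complex.integral_boundary_rect_eq_zero_of_differentiableOn G
      ⟨0, -T⟩ ⟨T, T⟩ (hGd.mono fun ζ hζ => by
        have h1 := hζ.1
        simp only [mem_preimage, uIcc_of_le hT0.le] at h1
        exact h1.1)
    simp only [Complex.ofReal_zero, zero_add, smul_eq_mul] at hrect
    have h1 : ‖∫ u in (0 : ℝ)..T, G (u + ((-T : ℝ) : ℂ) * Complex.I)‖ ≤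
        2 * C / (T ^ 2 - x ^ 2) * |T - 0| := by
      refine intervalIntegral.norm_integral_le_of_norm_le_const fun u hu => hb T hT _ ?_ ?_
      · rw [uIoc_of_le hT0.le] at hu
        simpa using hu.1.le
      · have := Complex.abs_im_le_norm (u + ((-T : ℝ) : ℂ) * Complex.I)
        simp [abs_of_pos hT0] at this ⊢
        exact this
    have h2 : ‖∫ u in (0 : ℝ)..T, G (u + (T : ℂ) * Complex.I)‖ ≤
        2 * C / (T ^ 2 - x ^ 2) * |T - 0| := by
      refine intervalIntegral.norm_integral_le_of_norm_le_const fun u hu => hb T hT _ ?_ ?_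
      · rw [uIoc_of_le hT0.le] at hu
        simpa using hu.1.le
      · have := Complex.abs_im_le_norm (u + (T : ℂ) * Complex.I)
        simp [abs_of_pos hT0] at this ⊢
        exact this
    have h3 : ‖∫ s in (-T)..T, G (T + (s : ℂ) * Complex.I)‖ ≤
        2 * C / (T ^ 2 - x ^ 2) * |T - -T| := by
      refine intervalIntegral.norm_integral_le_of_norm_le_const fun s hs => hb T hT _ ?_ ?_
      · simpa using hT0.le
      · have := Complex.abs_re_le_norm (T + (s : ℂ) * Complex.I)
        simp [abs_of_pos hT0] at this ⊢
        exact this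
    have h4 : Complex.I * ∫ s in (-T)..T, G (s * Complex.I) =
        (∫ u in (0 : ℝ)..T, G (u + ((-T : ℝ) : ℂ) * Complex.I)) -
        (∫ u in (0 : ℝ)..T, G (u + (T : ℂ) * Complex.I)) +
        Complex.I * ∫ s in (-T)..T, G (T + (s : ℂ) * Complex.I) :=
      (sub_eq_zero.1 hrect).symm
    have h5 := congrArg norm h4
    rw [norm_mul, Complex.norm_I, one_mul] at h5
    rw [h5]
    refine (norm_add_le _ _).trans ?_
    rw [norm_mul, Complex.norm_I, one_mul]
    have h6 := norm_sub_le (∫ u in (0 : ℝ)..T, G (u + ((-T : ℝ) : ℂ) * Complex.I))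
      (∫ u in (0 : ℝ)..T, G (u + (T : ℂ) * Complex.I))
    rw [sub_zero, abs_of_pos hT0] at h1 h2
    rw [show T - -T = 2 * T by ring, abs_of_pos (by linarith)] at h3
    have h7 : 8 * C * (T / (T ^ 2 - x ^ 2)) = 2 * C / (T ^ 2 - x ^ 2) * T +
      2 * C / (T ^ 2 - x ^ 2) * T + 2 * C / (T ^ 2 - x ^ 2) * (2 * T) := by ring
    linarith
  have hi' : Integrable fun s : ℝ => R x * (((x ^ 2 + s ^ 2)⁻¹ : ℝ) : ℂ) := hi.ofReal.const_mul _
  have hGint : Integrable fun s : ℝ => G (s * Complex.I) := by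
    simp_rw [hGI]
    exact hi'.sub hRint
  have hlim := intervalIntegral_tendsto_integral hGint Filter.tendsto_neg_atTop_atBot
    Filter.tendsto_id
  have hT : Filter.Tendsto (fun T : ℝ => 8 * C * (T / (T ^ 2 - x ^ 2))) Filter.atTop
      (nhds 0) := by
    have h1 : Filter.Tendsto (fun T : ℝ => T - x ^ 2 * T⁻¹) Filter.atTop Filter.atTop := by
      have := (tendsto_inv_atTop_zero (𝕜 := ℝ)).const_mul (-x ^ 2)
      simpa [sub_eq_add_neg] using Filter.Tendsto.atTop_add Filter.tendsto_id this
    have h2 := (tendsto_inv_atTop_zero.comp h1).const_mul (8 * C)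
    rw [mul_zero] at h2
    refine h2.congr' ?_
    filter_upwards [Filter.eventually_gt_atTop x] with T hT
    have hT0 : 0 < T := hx.trans hT
    have : T - x ^ 2 * T⁻¹ = (T ^ 2 - x ^ 2) / T := by field_simp
    simp [this]
  have hz : ∫ s : ℝ, G (s * Complex.I) = 0 := by
    refine tendsto_nhds_unique hlim (squeeze_zero_norm' ?_ hT)
    filter_upwards [Filter.eventually_gt_atTop x] with T hT using hbound T hT
  simp_rw [hGI] at hz
  rw [integral_sub hi' hRint, integral_const_mul, integral_complex_ofReal, hv,
    sub_eq_zero] at hz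
  rw [← hz]
  push_cast
  rfl

/-- Up to the factor `2 Γ(ν)`, the squared modulus of `hermiteIntegral ν (x + i y)`. -/
noncomputable def hermiteModulus (ν x y : ℝ) : ℝ :=
  ∫ u in Ioi (0 : ℝ), Real.exp (-(x ^ 2 / u ^ 2) - y ^ 2 / (1 + u ^ 2)) *
    ((2 + 4 * u ^ 2) ^ (-ν) * (√(1 + u ^ 2))⁻¹)

lemma integrable_hermiteWeight {ν : ℝ} (hν : 0 < ν) :
    Integrable fun u : ℝ => (2 + 4 * u ^ 2) ^ (-ν) * (√(1 + u ^ 2))⁻¹ := by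
  have h := integrable_rpow_neg_one_add_norm_sq (E := ℝ) (μ := volume) (r := 2 * ν + 1)
    (by simp; linarith)
  refine Integrable.mono' h (Measurable.aestronglyMeasurable (by fun_prop))
    (.of_forall fun u => ?_)
  have h1 : 0 < 1 + u ^ 2 := by positivity
  have h2 : 0 < 2 + 4 * u ^ 2 := by positivity
  rw [Real.norm_of_nonneg (by positivity), Real.norm_eq_abs, sq_abs,
    show -(2 * ν + 1) / 2 = -ν + -(1 / 2) by ring, Real.rpow_add h1, Real.rpow_neg h1.le (1 / 2),
    ← Real.sqrt_eq_rpow]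
  refine mul_le_mul_of_nonneg_right ?_ (by positivity)
  exact Real.rpow_le_rpow_of_nonpos h1 (by nlinarith [sq_nonneg u]) (by linarith)

lemma integrableOn_hermiteModulus {ν : ℝ} (hν : 0 < ν) (x y : ℝ) :
    IntegrableOn (fun u : ℝ => Real.exp (-(x ^ 2 / u ^ 2) - y ^ 2 / (1 + u ^ 2)) *
      ((2 + 4 * u ^ 2) ^ (-ν) * (√(1 + u ^ 2))⁻¹)) (Ioi 0) := by
  refine Integrable.mono' (integrable_hermiteWeight hν).integrableOn
    (Measurable.aestronglyMeasurable (by fun_prop)) (.of_forall fun u => ?_)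
  have h1 : 0 ≤ x ^ 2 / u ^ 2 := by positivity
  have h2 : 0 ≤ y ^ 2 / (1 + u ^ 2) := by positivity
  rw [Real.norm_of_nonneg (by positivity)]
  exact mul_le_of_le_one_left (by positivity) (Real.exp_le_one_iff.2 (by linarith))

lemma hermiteModulus_pos {ν : ℝ} (hν : 0 < ν) (x y : ℝ) : 0 < hermiteModulus ν x y := by
  refine (setIntegral_pos_iff_support_of_nonneg_ae (.of_forall fun u => ?_)
    (integrableOn_hermiteModulus hν x y)).2 ?_
  · simp only [Pi.zero_apply]
    positivity
  · refine lt_of_lt_of_le (b := volume (Ioi (0 : ℝ))) (by simp) (measure_mono fun u hu => ?_)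
    refine ⟨?_, hu⟩
    simp only [Function.mem_support]
    positivity

lemma integrableOn_rpow_mul_exp_neg_mul {ν c : ℝ} (hν : 0 < ν) (hc : 0 < c) :
    IntegrableOn (fun p : ℝ => p ^ (ν - 1) * Real.exp (-(c * p))) (Ioi 0) := by
  have h := integrableOn_rpow_mul_exp_neg_mul_rpow (p := 1) (s := ν - 1) (b := c)
    (by linarith) one_pos hc
  simpa using h

/-- The integrand of the triple integral that expresses the squared modulus. -/
noncomputable def hermiteKernel (ν x y : ℝ) (q : ℝ × ℝ) (u : ℝ) : ℂ :=
  ((q.1 ^ (ν - 1) * Real.exp (-((2 + 4 * u ^ 2) * q.1)) : ℝ) : ℂ) *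
    (Complex.exp (Complex.I * ((-2 * y : ℝ) : ℂ) * q.2) *
      Complex.exp (-((1 + u ^ 2 : ℝ) : ℂ) * q.2 ^ 2)) * (Real.exp (-(x ^ 2 / u ^ 2)) : ℝ)

lemma norm_hermiteKernel (ν x y : ℝ) {q : ℝ × ℝ} (hq : 0 < q.1) (u : ℝ) :
    ‖hermiteKernel ν x y q u‖ = q.1 ^ (ν - 1) * Real.exp (-((2 + 4 * u ^ 2) * q.1)) *
      Real.exp (-(1 + u ^ 2) * q.2 ^ 2) * Real.exp (-(x ^ 2 / u ^ 2)) := by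
  have h : 0 ≤ q.1 ^ (ν - 1) := Real.rpow_nonneg hq.le _
  rw [hermiteKernel, norm_mul, norm_mul, norm_mul, Complex.norm_real, Complex.norm_real,
    Real.norm_of_nonneg (by positivity), Real.norm_of_nonneg (by positivity),
    Complex.norm_exp, Complex.norm_exp]
  have h1 : (Complex.I * ((-2 * y : ℝ) : ℂ) * q.2).re = 0 := by simp
  have h2 : (-((1 + u ^ 2 : ℝ) : ℂ) * q.2 ^ 2).re = -(1 + u ^ 2) * q.2 ^ 2 := by
    rw [← Complex.ofReal_pow, ← Complex.ofReal_neg, ← Complex.ofReal_mul, Complex.ofReal_re]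
  rw [h1, h2, Real.exp_zero, one_mul]

lemma integral_hermiteKernel_left {ν : ℝ} (hν : 0 < ν) (x y u : ℝ) :
    ∫ q, hermiteKernel ν x y q u ∂((volume.restrict (Ioi 0)).prod volume) =
      ((Real.Gamma ν * √Real.pi * (Real.exp (-(x ^ 2 / u ^ 2) - y ^ 2 / (1 + u ^ 2)) *
        ((2 + 4 * u ^ 2) ^ (-ν) * (√(1 + u ^ 2))⁻¹)) : ℝ) : ℂ) := by
  have h2 : 0 < 2 + 4 * u ^ 2 := by positivity
  have h1 : 0 < 1 + u ^ 2 := by positivity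
  simp only [hermiteKernel]
  rw [integral_mul_const, integral_prod_mul (fun p : ℝ =>
    ((p ^ (ν - 1) * Real.exp (-((2 + 4 * u ^ 2) * p)) : ℝ) : ℂ)) (fun w : ℝ =>
    Complex.exp (Complex.I * ((-2 * y : ℝ) : ℂ) * w) *
      Complex.exp (-((1 + u ^ 2 : ℝ) : ℂ) * w ^ 2)), integral_complex_ofReal,
    Real.integral_rpow_mul_exp_neg_mul_Ioi hν h2,
    fourierIntegral_gaussian (by rw [Complex.ofReal_re]; exact h1)]
  have e1 : ((Real.pi : ℂ) / ((1 + u ^ 2 : ℝ) : ℂ)) ^ (1 / 2 : ℂ) =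
      ((√Real.pi * (√(1 + u ^ 2))⁻¹ : ℝ) : ℂ) := by
    rw [← Complex.ofReal_div, show (1 / 2 : ℂ) = ((1 / 2 : ℝ) : ℂ) by simp,
      ← Complex.ofReal_cpow (by positivity), ← Real.sqrt_eq_rpow, Real.sqrt_div' _ h1.le,
      div_eq_mul_inv]
  have e2 : -((-2 * y : ℝ) : ℂ) ^ 2 / (4 * ((1 + u ^ 2 : ℝ) : ℂ)) =
      ((-(y ^ 2 / (1 + u ^ 2)) : ℝ) : ℂ) := by
    have : ((1 + u ^ 2 : ℝ) : ℂ) ≠ 0 := by exact_mod_cast h1.ne'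
    push_cast at this ⊢
    field_simp
    ring
  rw [e1, e2, ← Complex.ofReal_exp, ← Complex.ofReal_mul, ← Complex.ofReal_mul,
    ← Complex.ofReal_mul, sub_eq_add_neg, Real.exp_add, one_div, Real.inv_rpow h2.le,
    ← Real.rpow_neg h2.le]
  congr 1
  ring

lemma measurable_hermiteKernel (ν x y : ℝ) :
    Measurable (Function.uncurry (hermiteKernel ν x y)) := by
  unfold hermiteKernel Function.uncurry
  fun_prop

lemma ae_fst_pos : ∀ᵐ q ∂((volume.restrict (Ioi (0 : ℝ))).prod (volume : Measure ℝ)),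
    0 < q.1 :=
  (Measure.quasiMeasurePreserving_fst (μ := volume.restrict (Ioi (0 : ℝ)))
    (ν := (volume : Measure ℝ))).ae (ae_restrict_mem measurableSet_Ioi)

lemma integrable_hermiteKernel {ν : ℝ} (hν : 0 < ν) (x y : ℝ) :
    Integrable (Function.uncurry (hermiteKernel ν x y))
      (((volume.restrict (Ioi (0 : ℝ))).prod (volume : Measure ℝ)).prod
        (volume.restrict (Ioi 0))) := by
  refine (integrable_prod_iff' (measurable_hermiteKernel ν x y).aestronglyMeasurable).2
    ⟨.of_forall fun u => ?_, ?_⟩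
  · have h2 : 0 < 2 + 4 * u ^ 2 := by positivity
    have h1 : 0 < 1 + u ^ 2 := by positivity
    have h := ((integrableOn_rpow_mul_exp_neg_mul hν h2).mul_prod
      (integrable_exp_neg_mul_sq h1)).mul_const (Real.exp (-(x ^ 2 / u ^ 2)))
    refine Integrable.mono' h ((measurable_hermiteKernel ν x y).comp
      measurable_prodMk_right).aestronglyMeasurable ?_
    filter_upwards [ae_fst_pos] with q hq
    exact (norm_hermiteKernel ν x y hq u).le
  · refine (((integrableOn_hermiteModulus hν x 0).const_mul
      (Real.Gamma ν * √Real.pi))).congr (.of_forall fun u => ?_)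
    have h := integral_hermiteKernel_left hν x 0 u
    simp only
    rw [← Complex.ofReal_inj, ← h, ← integral_complex_ofReal]
    refine integral_congr_ae ?_
    filter_upwards [ae_fst_pos] with q hq
    simp only [Function.uncurry]
    rw [norm_hermiteKernel ν x y hq u, hermiteKernel]
    push_cast
    simp

lemma integral_hermiteKernel_right (ν : ℝ) {x : ℝ} (hx : 0 ≤ x) (y : ℝ) {q : ℝ × ℝ}
    (hq : 0 < q.1) :
    ∫ u in Ioi (0 : ℝ), hermiteKernel ν x y q u = ((√Real.pi / 2 : ℝ) : ℂ) *
      (Complex.exp (Complex.I * ((-2 * y : ℝ) : ℂ) * q.2) *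
      ((q.1 ^ (ν - 1) * Real.exp (-2 * q.1 - q.2 ^ 2 - 2 * x * √(q.2 ^ 2 + 4 * q.1)) /
        √(q.2 ^ 2 + 4 * q.1) : ℝ) : ℂ)) := by
  have hv0 : 0 < q.2 ^ 2 + 4 * q.1 := by positivity
  have hv : 0 < √(q.2 ^ 2 + 4 * q.1) := Real.sqrt_pos.2 hv0
  have h : ∀ u : ℝ, hermiteKernel ν x y q u =
      Complex.exp (Complex.I * ((-2 * y : ℝ) : ℂ) * q.2) *
        ((q.1 ^ (ν - 1) * Real.exp (-2 * q.1 - q.2 ^ 2) : ℝ) : ℂ) *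
        ((Real.exp (-(u ^ 2 * √(q.2 ^ 2 + 4 * q.1) ^ 2) - x ^ 2 / u ^ 2) : ℝ) : ℂ) := by
    intro u
    rw [Real.sq_sqrt hv0.le, hermiteKernel]
    have e : Complex.exp (-((1 + u ^ 2 : ℝ) : ℂ) * q.2 ^ 2) =
        ((Real.exp (-(1 + u ^ 2) * q.2 ^ 2) : ℝ) : ℂ) := by push_cast; rfl
    rw [e]
    have e2 : Real.exp (-((2 + 4 * u ^ 2) * q.1)) * Real.exp (-(1 + u ^ 2) * q.2 ^ 2) *
        Real.exp (-(x ^ 2 / u ^ 2)) = Real.exp (-2 * q.1 - q.2 ^ 2) *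
        Real.exp (-(u ^ 2 * (q.2 ^ 2 + 4 * q.1)) - x ^ 2 / u ^ 2) := by
      rw [← Real.exp_add, ← Real.exp_add, ← Real.exp_add]
      congr 1
      ring
    have e3 := congrArg (fun r : ℝ => (r : ℂ)) e2
    simp only [Complex.ofReal_mul] at e3 ⊢
    linear_combination Complex.exp (Complex.I * (((-2 : ℝ) : ℂ) * y) * q.2) *
      ((q.1 ^ (ν - 1) : ℝ) : ℂ) * e3
  simp_rw [h]
  rw [integral_const_mul, integral_complex_ofReal, integral_exp_neg_sq_sub_inv_sq hx hv,
    sub_eq_add_neg (-2 * q.1 - q.2 ^ 2) (2 * x * _), Real.exp_add (-2 * q.1 - q.2 ^ 2),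
    show -(2 * x * √(q.2 ^ 2 + 4 * q.1)) = -2 * x * √(q.2 ^ 2 + 4 * q.1) by ring]
  push_cast
  ring

lemma norm_sq_hermiteIntegral {ν x : ℝ} (hν : 0 < ν) (hx : 0 ≤ x) (y : ℝ) :
    ‖hermiteIntegral ν (x + y * Complex.I)‖ ^ 2 =
      2 * Real.Gamma ν * hermiteModulus ν x y := by
  set g : ℝ × ℝ → ℂ := fun q => Complex.exp (Complex.I * ((-2 * y : ℝ) : ℂ) * q.2) *
      ((q.1 ^ (ν - 1) * Real.exp (-2 * q.1 - q.2 ^ 2 - 2 * x * √(q.2 ^ 2 + 4 * q.1)) /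
        √(q.2 ^ 2 + 4 * q.1) : ℝ) : ℂ) with hg
  have hvol : (volume : Measure (ℝ × ℝ)).restrict (Ioi (0 : ℝ) ×ˢ univ) =
      (volume.restrict (Ioi (0 : ℝ))).prod (volume : Measure ℝ) := by
    rw [Measure.volume_eq_prod, ← Measure.prod_restrict, Measure.restrict_univ]
  have h1 : ((√Real.pi / 2 : ℝ) : ℂ) * ∫ q in Ioi (0 : ℝ) ×ˢ (univ : Set ℝ), g q =
      ((Real.Gamma ν * √Real.pi * hermiteModulus ν x y : ℝ) : ℂ) := by
    rw [← integral_const_mul, hvol]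
    calc _ = ∫ q, (∫ u in Ioi (0 : ℝ), hermiteKernel ν x y q u)
          ∂((volume.restrict (Ioi (0 : ℝ))).prod (volume : Measure ℝ)) := by
            refine integral_congr_ae ?_
            filter_upwards [ae_fst_pos] with q hq
            exact (integral_hermiteKernel_right ν hx y hq).symm
      _ = _ := by
            rw [integral_integral_swap (integrable_hermiteKernel hν x y)]
            simp_rw [integral_hermiteKernel_left hν x y]
            rw [integral_complex_ofReal, integral_const_mul, hermiteModulus]
  have h2 : ∫ q in Ioi (0 : ℝ) ×ˢ (univ : Set ℝ), g q =
      hermiteIntegral ν (x + y * Complex.I) *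
        (starRingEnd ℂ) (hermiteIntegral ν (x + y * Complex.I)) := by
    rw [setIntegral_comp_mul_sub, hermiteIntegral, ← integral_conj, ← setIntegral_prod_mul]
    refine setIntegral_congr_fun (measurableSet_Ioi.prod measurableSet_Ioi) ?_
    rintro ⟨t, r⟩ ⟨ht, hr⟩
    simp only [mem_Ioi] at ht hr
    have hs : √((t - r) ^ 2 + 4 * (t * r)) = t + r := by
      rw [show (t - r) ^ 2 + 4 * (t * r) = (t + r) ^ 2 by ring, Real.sqrt_sq (by positivity)]
    have htr : ((t : ℂ) + r) ≠ 0 := by exact_mod_cast (add_pos ht hr).ne'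
    simp only [hg, hs, map_mul, ← Complex.exp_conj, Complex.conj_ofReal, Complex.real_smul,
      Real.mul_rpow ht.le hr.le]
    push_cast
    have e : Complex.exp (Complex.I * (-2 * y) * (t - r)) *
        Complex.exp (-2 * (t * r) - (t - r) ^ 2 - 2 * x * (t + r)) =
        Complex.exp (-(t : ℂ) ^ 2 - 2 * t * (x + y * Complex.I)) *
        Complex.exp ((starRingEnd ℂ) (-(r : ℂ) ^ 2 - 2 * r * (x + y * Complex.I))) := by
      rw [← Complex.exp_add, ← Complex.exp_add]
      congr 1
      simp only [map_sub, map_neg, map_mul, map_add, map_pow, Complex.conj_ofReal,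
        Complex.conj_I, map_ofNat]
      ring
    have hc := mul_inv_cancel₀ htr
    rw [div_eq_mul_inv]
    linear_combination ((t ^ (ν - 1) : ℝ) : ℂ) * ((r ^ (ν - 1) : ℝ) : ℂ) * e +
      Complex.exp (Complex.I * (-2 * y) * (t - r)) *
      ((t ^ (ν - 1) : ℝ) : ℂ) * ((r ^ (ν - 1) : ℝ) : ℂ) *
      Complex.exp (-2 * (t * r) - (t - r) ^ 2 - 2 * x * (t + r)) * hc
  rw [h2, Complex.mul_conj, ← Complex.ofReal_mul, Complex.ofReal_inj, Complex.normSq_eq_norm_sq]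
    at h1
  have : 0 < √Real.pi := Real.sqrt_pos.2 Real.pi_pos
  have h3 : √Real.pi * (‖hermiteIntegral ν (x + y * Complex.I)‖ ^ 2) =
      √Real.pi * (2 * Real.Gamma ν * hermiteModulus ν x y) := by linear_combination 2 * h1
  exact mul_left_cancel₀ this.ne' h3

lemma hermiteIntegral_ne_zero {ν : ℝ} (hν : 0 < ν) {ζ : ℂ} (hζ : 0 ≤ ζ.re) :
    hermiteIntegral ν ζ ≠ 0 := by
  have h := norm_sq_hermiteIntegral hν hζ ζ.im
  rw [Complex.re_add_im] at h
  intro h0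
  have h1 := Real.Gamma_pos_of_pos hν
  have h2 := hermiteModulus_pos hν ζ.re ζ.im
  rw [h0, norm_zero] at h
  have : 0 < 2 * Real.Gamma ν * hermiteModulus ν ζ.re ζ.im := by positivity
  simp at h
  rcases h with h | h <;> linarith

lemma hermiteModulus_add_one_le {ν : ℝ} (hν : 0 < ν) (x y : ℝ) :
    hermiteModulus (ν + 1) x y ≤ 1 / 2 * hermiteModulus ν x y := by
  rw [hermiteModulus, hermiteModulus, ← integral_const_mul]
  refine setIntegral_mono (integrableOn_hermiteModulus (by linarith) x y)
    ((integrableOn_hermiteModulus hν x y).const_mul _) fun u => ?_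
  have h2 : 0 < 2 + 4 * u ^ 2 := by positivity
  have h3 : (2 + 4 * u ^ 2)⁻¹ ≤ 1 / 2 := by
    rw [one_div]
    exact inv_anti₀ two_pos (by nlinarith [sq_nonneg u])
  have h4 : (2 + 4 * u ^ 2) ^ (-(ν + 1)) = (2 + 4 * u ^ 2) ^ (-ν) * (2 + 4 * u ^ 2)⁻¹ := by
    rw [neg_add, Real.rpow_add h2, Real.rpow_neg_one]
  simp only [h4]
  have h5 : 0 ≤ Real.exp (-(x ^ 2 / u ^ 2) - y ^ 2 / (1 + u ^ 2)) *
    ((2 + 4 * u ^ 2) ^ (-ν) * (√(1 + u ^ 2))⁻¹) := by positivity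
  nlinarith [mul_le_mul_of_nonneg_left h3 h5]

/-- Minus one half of the logarithmic derivative of `hermiteIntegral ν`. -/
noncomputable def hermiteRatio (ν : ℝ) (ζ : ℂ) : ℂ :=
  hermiteIntegral (ν + 1) ζ / hermiteIntegral ν ζ

lemma differentiableAt_hermiteRatio {ν : ℝ} (hν : 0 < ν) {ζ : ℂ} (hζ : 0 ≤ ζ.re) :
    DifferentiableAt ℂ (hermiteRatio ν) ζ :=
  (hasDerivAt_hermiteIntegral (by linarith) ζ).differentiableAt.div
    (hasDerivAt_hermiteIntegral hν ζ).differentiableAt (hermiteIntegral_ne_zero hν hζ)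

lemma norm_hermiteRatio_le {ν : ℝ} (hν : 0 < ν) {ζ : ℂ} (hζ : 0 ≤ ζ.re) :
    ‖hermiteRatio ν ζ‖ ≤ √(ν / 2) := by
  have h0 := norm_sq_hermiteIntegral hν hζ ζ.im
  have h1 := norm_sq_hermiteIntegral (ν := ν + 1) (by linarith) hζ ζ.im
  rw [Complex.re_add_im] at h0 h1
  have hne : 0 < ‖hermiteIntegral ν ζ‖ := norm_pos_iff.2 (hermiteIntegral_ne_zero hν hζ)
  have hΓ := Real.Gamma_pos_of_pos hν
  refine Real.le_sqrt_of_sq_le ?_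
  rw [hermiteRatio, norm_div, div_pow, div_le_iff₀ (by positivity), h0, h1,
    Real.Gamma_add_one hν.ne']
  nlinarith [mul_le_mul_of_nonneg_left (hermiteModulus_add_one_le hν ζ.re ζ.im)
    (by positivity : 0 ≤ 2 * (ν * Real.Gamma ν))]

lemma hasDerivAt_hermiteIntegral_mul_I {ν : ℝ} (hν : 0 < ν) (s : ℝ) :
    HasDerivAt (fun s : ℝ => hermiteIntegral ν (s * Complex.I))
      (-2 * hermiteIntegral (ν + 1) (s * Complex.I) * Complex.I) s := by
  have h1 : HasDerivAt (fun s : ℝ => (s : ℂ) * Complex.I) (1 * Complex.I) s :=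
    Complex.ofRealCLM.hasDerivAt.mul_const _
  have h2 := (hasDerivAt_hermiteIntegral hν (s * Complex.I)).comp s h1
  rw [one_mul] at h2
  exact h2

lemma re_hermiteIntegral_mul_conj {ν : ℝ} (hν : 0 < ν) (s : ℝ) :
    (hermiteIntegral (ν + 1) (s * Complex.I) *
      (starRingEnd ℂ) (hermiteIntegral ν (s * Complex.I))).re =
      (hermiteIntegral (ν + 1) (0 : ℝ)).re * (hermiteIntegral ν (0 : ℝ)).re *
        Real.exp (-s ^ 2) := by
  set W : ℝ → ℝ := fun s => (hermiteIntegral (ν + 1) (s * Complex.I) *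
      (starRingEnd ℂ) (hermiteIntegral ν (s * Complex.I))).re with hW
  have hd : ∀ s, HasDerivAt W (-2 * s * W s) s := fun s => by
    have h0 := hasDerivAt_hermiteIntegral_mul_I hν s
    have h1 := hasDerivAt_hermiteIntegral_mul_I (ν := ν + 1) (by linarith) s
    have h2 := Complex.reCLM.hasFDerivAt.comp_hasDerivAt s
      (h1.mul ((Complex.conjCLE : ℂ →L[ℝ] ℂ).hasFDerivAt.comp_hasDerivAt s h0))
    refine h2.congr_deriv ?_
    have hr := hermiteIntegral_recurrence hν (s * Complex.I)
    rw [show ν + 1 + 1 = ν + 2 by ring]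
    have hr' : hermiteIntegral (ν + 2) (s * Complex.I) =
        (ν * hermiteIntegral ν (s * Complex.I) -
          2 * (s * Complex.I) * hermiteIntegral (ν + 1) (s * Complex.I)) / 2 := by
      rw [hr]; ring
    rw [hr']
    simp [hW]
    ring
  have hconst : ∀ s, HasDerivAt (fun s => W s * Real.exp (s ^ 2)) 0 s := fun s =>
    ((hd s).mul ((hasDerivAt_pow 2 s).exp)).congr_deriv (by push_cast; ring)
  have h := is_const_of_deriv_eq_zero (fun s => (hconst s).differentiableAt)
    (fun s => (hconst s).deriv) s 0
  have h0 : W 0 = (hermiteIntegral (ν + 1) (0 : ℝ)).re * (hermiteIntegral ν (0 : ℝ)).re := by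
    have e1 := hermiteIntegral_ofReal_eq_re (ν + 1) 0
    have e2 := hermiteIntegral_ofReal_eq_re ν 0
    simp only [hW]
    rw [Complex.ofReal_zero, zero_mul, ← Complex.ofReal_zero, e1, e2]
    simp
  simp only [h0, ne_eq, OfNat.ofNat_ne_zero, not_false_eq_true, zero_pow, Real.exp_zero,
    mul_one] at h
  rw [← h, mul_assoc, ← Real.exp_add]
  simp [hW]

/-- The Stieltjes density, up to a constant, of the logarithmic derivative. -/
noncomputable def hermiteDensity (ν s : ℝ) : ℝ := Real.exp (-s ^ 2) / hermiteModulus ν 0 s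

lemma hermiteDensity_pos {ν : ℝ} (hν : 0 < ν) (s : ℝ) : 0 < hermiteDensity ν s :=
  div_pos (Real.exp_pos _) (hermiteModulus_pos hν 0 s)

lemma exists_re_hermiteRatio_eq {ν : ℝ} (hν : 0 < ν) :
    ∃ c, 0 < c ∧ ∀ s : ℝ, (hermiteRatio ν (s * Complex.I)).re = c * hermiteDensity ν s := by
  have hΓ := Real.Gamma_pos_of_pos hν
  have p0 := hermiteIntegral_ofReal_re_pos hν 0
  have p1 := hermiteIntegral_ofReal_re_pos (ν := ν + 1) (by linarith) 0
  refine ⟨(hermiteIntegral (ν + 1) (0 : ℝ)).re * (hermiteIntegral ν (0 : ℝ)).re /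
    (2 * Real.Gamma ν), by positivity, fun s => ?_⟩
  have h := norm_sq_hermiteIntegral hν le_rfl s
  rw [Complex.ofReal_zero, zero_add] at h
  have hm := hermiteModulus_pos hν 0 s
  rw [hermiteRatio, div_eq_mul_inv, Complex.inv_def, ← mul_assoc, Complex.re_mul_ofReal,
    re_hermiteIntegral_mul_conj hν, Complex.normSq_eq_norm_sq, h, hermiteDensity]
  field_simp

lemma continuous_hermiteDensity {ν : ℝ} (hν : 0 < ν) : Continuous (hermiteDensity ν) := by
  obtain ⟨c, hc, h⟩ := exists_re_hermiteRatio_eq hν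
  have e : hermiteDensity ν = fun s : ℝ => c⁻¹ * (hermiteRatio ν (s * Complex.I)).re := by
    funext s
    rw [h, inv_mul_cancel_left₀ hc.ne']
  rw [e, continuous_iff_continuousAt]
  intro s
  have h1 : ContinuousAt (hermiteRatio ν) (s * Complex.I) :=
    (differentiableAt_hermiteRatio hν (by simp)).continuousAt
  have h2 : ContinuousAt (fun s : ℝ => hermiteRatio ν (s * Complex.I)) s :=
    ContinuousAt.comp (f := fun s : ℝ => (s : ℂ) * Complex.I) h1 (by fun_prop)
  exact (Complex.continuous_re.continuousAt.comp h2).const_mul _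

lemma integrable_hermiteDensity {ν : ℝ} (hν : 0 < ν) : Integrable (hermiteDensity ν) := by
  set A := ∫ u in Ioi (1 : ℝ), (2 + 4 * u ^ 2) ^ (-ν) * (√(1 + u ^ 2))⁻¹ with hA
  have hApos : 0 < A := by
    refine (setIntegral_pos_iff_support_of_nonneg_ae (.of_forall fun u => ?_)
      (integrable_hermiteWeight hν).integrableOn).2 ?_
    · simp only [Pi.zero_apply]
      positivity
    · refine lt_of_lt_of_le (b := volume (Ioi (1 : ℝ))) (by simp) (measure_mono fun u hu => ?_)
      refine ⟨?_, hu⟩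
      simp only [Function.mem_support]
      positivity
  have hle : ∀ s, Real.exp (-(s ^ 2 / 2)) * A ≤ hermiteModulus ν 0 s := fun s => by
    rw [hA, ← integral_const_mul, hermiteModulus]
    refine le_trans (setIntegral_mono_on ((integrable_hermiteWeight hν).const_mul _).integrableOn
      ((integrableOn_hermiteModulus hν 0 s).mono_set (Ioi_subset_Ioi zero_le_one))
      measurableSet_Ioi fun u hu => ?_) (setIntegral_mono_set
        (integrableOn_hermiteModulus hν 0 s) (.of_forall fun u => ?_)
        (Ioi_subset_Ioi zero_le_one).eventuallyLE)
    · have hu1 : 1 < u := hu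
      have : s ^ 2 / (1 + u ^ 2) ≤ s ^ 2 / 2 :=
        div_le_div_of_nonneg_left (sq_nonneg s) two_pos (by nlinarith)
      refine mul_le_mul_of_nonneg_right (Real.exp_le_exp.2 ?_) (by positivity)
      simp only [ne_eq, OfNat.ofNat_ne_zero, not_false_eq_true, zero_pow, zero_div, neg_zero]
      linarith
    · simp only [Pi.zero_apply]
      positivity
  have hg := (integrable_exp_neg_mul_sq (b := 1 / 2) (by norm_num)).const_mul A⁻¹
  refine hg.mono' (continuous_hermiteDensity hν).aestronglyMeasurable (.of_forall fun s => ?_)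
  rw [Real.norm_of_nonneg (hermiteDensity_pos hν s).le, hermiteDensity,
    div_le_iff₀ (hermiteModulus_pos hν 0 s)]
  refine le_trans (le_of_eq ?_) (mul_le_mul_of_nonneg_left (hle s) (by positivity))
  rw [show A⁻¹ * Real.exp (-(1 / 2) * s ^ 2) * (Real.exp (-(s ^ 2 / 2)) * A) =
    (A⁻¹ * A) * (Real.exp (-(1 / 2) * s ^ 2) * Real.exp (-(s ^ 2 / 2))) by ring,
    inv_mul_cancel₀ hApos.ne', one_mul, ← Real.exp_add]
  congr 1
  ring

lemma hermiteRatio_ofReal (ν x : ℝ) :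
    hermiteRatio ν x =
      (((hermiteIntegral (ν + 1) x).re / (hermiteIntegral ν x).re : ℝ) : ℂ) := by
  rw [hermiteRatio, hermiteIntegral_ofReal_eq_re (ν + 1), hermiteIntegral_ofReal_eq_re ν]
  simp

lemma integral_re_hermiteRatio_div {ν x : ℝ} (hν : 0 < ν) (hx : 0 < x) :
    ∫ s : ℝ, (hermiteRatio ν (s * Complex.I)).re / (x ^ 2 + s ^ 2) =
      (hermiteRatio ν x).re * (Real.pi / x) := by
  obtain ⟨hi, he⟩ := poisson_rightHalfPlane (R := hermiteRatio ν)
    (fun ζ hζ => differentiableAt_hermiteRatio hν hζ)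
    (fun ζ hζ => norm_hermiteRatio_le hν hζ) hx
  have h := congrArg Complex.re he
  rw [← Complex.ofReal_div, Complex.re_mul_ofReal] at h
  rw [← h]
  have h2 := Complex.reCLM.integral_comp_comm hi
  simp only [Complex.reCLM_apply, Complex.div_ofReal_re] at h2
  exact h2

lemma hermiteRatio_re_pos {ν : ℝ} (hν : 0 < ν) (x : ℝ) : 0 < (hermiteRatio ν x).re := by
  rw [hermiteRatio_ofReal, Complex.ofReal_re]
  exact div_pos (hermiteIntegral_ofReal_re_pos (by linarith) x)
    (hermiteIntegral_ofReal_re_pos hν x)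

lemma hermiteRatio_recurrence {ν : ℝ} (hν : 0 < ν) (x : ℝ) :
    ν = 2 * x * (hermiteRatio ν x).re +
      2 * (hermiteRatio ν x).re * (hermiteRatio (ν + 1) x).re := by
  have h := hermiteIntegral_recurrence hν x
  rw [hermiteIntegral_ofReal_eq_re ν, hermiteIntegral_ofReal_eq_re (ν + 1),
    hermiteIntegral_ofReal_eq_re (ν + 2)] at h
  norm_cast at h
  have p0 := hermiteIntegral_ofReal_re_pos hν x
  have p1 := hermiteIntegral_ofReal_re_pos (ν := ν + 1) (by linarith) x
  rw [hermiteRatio_ofReal, hermiteRatio_ofReal, Complex.ofReal_re, Complex.ofReal_re,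
    show ν + 1 + 1 = ν + 2 by ring]
  field_simp
  linarith

lemma hermiteRatio_re_le {ν x : ℝ} (hν : 0 < ν) (hx : 0 < x) :
    (hermiteRatio ν x).re ≤ ν / (2 * x) := by
  have h := hermiteRatio_recurrence hν x
  have p0 := hermiteRatio_re_pos hν x
  have p1 := hermiteRatio_re_pos (ν := ν + 1) (by linarith) x
  rw [le_div_iff₀ (by positivity)]
  nlinarith [mul_pos p0 p1]

lemma tendsto_mul_hermiteRatio {ν : ℝ} (hν : 0 < ν) :
    Filter.Tendsto (fun x : ℝ => x * (hermiteRatio ν x).re) Filter.atTop (nhds (ν / 2)) := by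
  have hsq : Filter.Tendsto (fun x : ℝ => ν / 2 - ν * (ν + 1) / 4 * (x ^ 2)⁻¹) Filter.atTop
      (nhds (ν / 2)) := by
    have h : Filter.Tendsto (fun x : ℝ => (x ^ 2)⁻¹) Filter.atTop (nhds 0) :=
      (Filter.tendsto_pow_atTop two_ne_zero).inv_tendsto_atTop
    simpa using (h.const_mul (ν * (ν + 1) / 4)).const_sub (ν / 2)
  refine tendsto_of_tendsto_of_tendsto_of_le_of_le' hsq tendsto_const_nhds ?_ ?_
  · filter_upwards [Filter.eventually_gt_atTop 0] with x hx
    have h := hermiteRatio_recurrence hν x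
    have p0 := hermiteRatio_re_pos hν x
    have p1 := hermiteRatio_re_pos (ν := ν + 1) (by linarith) x
    have l0 := hermiteRatio_re_le hν hx
    have l1 := hermiteRatio_re_le (ν := ν + 1) (by linarith) hx
    have hm := mul_le_mul l0 l1 p1.le (by positivity)
    have e : ν / (2 * x) * ((ν + 1) / (2 * x)) = ν * (ν + 1) / 4 * (x ^ 2)⁻¹ := by
      field_simp
      ring
    rw [e] at hm
    linarith
  · filter_upwards [Filter.eventually_gt_atTop 0] with x hx
    have l0 := hermiteRatio_re_le hν hx
    rw [le_div_iff₀ (by positivity)] at l0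
    linarith

lemma integrable_re_hermiteRatio {ν : ℝ} (hν : 0 < ν) :
    Integrable fun s : ℝ => (hermiteRatio ν (s * Complex.I)).re := by
  obtain ⟨c, -, h⟩ := exists_re_hermiteRatio_eq hν
  simp_rw [h]
  exact (integrable_hermiteDensity hν).const_mul c

lemma integral_re_hermiteRatio {ν : ℝ} (hν : 0 < ν) :
    ∫ s : ℝ, (hermiteRatio ν (s * Complex.I)).re = Real.pi * ν / 2 := by
  have hi := integrable_re_hermiteRatio hν
  have hlim : Filter.Tendsto (fun x : ℝ => ∫ s : ℝ,
      x ^ 2 / (x ^ 2 + s ^ 2) * (hermiteRatio ν (s * Complex.I)).re) Filter.atTop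
      (nhds (∫ s : ℝ, (hermiteRatio ν (s * Complex.I)).re)) := by
    refine tendsto_integral_filter_of_dominated_convergence
      (fun s => ‖(hermiteRatio ν (s * Complex.I)).re‖) ?_ ?_ hi.norm ?_
    · refine .of_forall fun x => AEStronglyMeasurable.mul ?_ hi.aestronglyMeasurable
      exact Measurable.aestronglyMeasurable (by fun_prop)
    · filter_upwards [Filter.eventually_gt_atTop 0] with x hx
      refine .of_forall fun s => ?_
      rw [norm_mul]
      refine mul_le_of_le_one_left (norm_nonneg _) ?_
      rw [Real.norm_of_nonneg (by positivity), div_le_one (by positivity)]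
      nlinarith [sq_nonneg s]
    · refine .of_forall fun s => ?_
      have h : Filter.Tendsto (fun x : ℝ => x ^ 2 / (x ^ 2 + s ^ 2)) Filter.atTop (nhds 1) := by
        have h1 : Filter.Tendsto (fun x : ℝ => (x ^ 2 + s ^ 2)⁻¹) Filter.atTop (nhds 0) :=
          (Filter.tendsto_atTop_add_const_right _ _
            (Filter.tendsto_pow_atTop two_ne_zero)).inv_tendsto_atTop
        have h2 := (h1.const_mul (s ^ 2)).const_sub 1
        rw [mul_zero, sub_zero] at h2
        refine h2.congr' ?_
        filter_upwards [Filter.eventually_gt_atTop 0] with x hx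
        have : 0 < x ^ 2 + s ^ 2 := by positivity
        field_simp
        ring
      simpa using h.mul_const ((hermiteRatio ν (s * Complex.I)).re)
  refine tendsto_nhds_unique hlim ?_
  have h := (tendsto_mul_hermiteRatio hν).const_mul Real.pi
  rw [← mul_div_assoc] at h
  refine h.congr' ?_
  filter_upwards [Filter.eventually_gt_atTop 0] with x hx
  have e := integral_re_hermiteRatio_div hν hx
  rw [show (fun s : ℝ => x ^ 2 / (x ^ 2 + s ^ 2) * (hermiteRatio ν (s * Complex.I)).re) =
    fun s : ℝ => x ^ 2 * ((hermiteRatio ν (s * Complex.I)).re / (x ^ 2 + s ^ 2)) from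
      funext fun s => by ring, integral_const_mul, e]
  field_simp

/-- The Chebyshev integral inequality for similarly ordered functions. -/
lemma integral_mul_integral_le_of_monovary {α : Type*} [MeasurableSpace α] {μ : Measure α}
    {w f g : α → ℝ} (hfg : ∀ a b, 0 ≤ (f a - f b) * (g a - g b)) (hw : ∀ a, 0 ≤ w a)
    (hi : Integrable w μ) (hf : Integrable (fun a => w a * f a) μ)
    (hg : Integrable (fun a => w a * g a) μ)
    (hfg' : Integrable (fun a => w a * (f a * g a)) μ) :
    (∫ a, w a * f a ∂μ) * ∫ a, w a * g a ∂μ ≤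
      (∫ a, w a ∂μ) * ∫ a, w a * (f a * g a) ∂μ := by
  set P := ∫ a, w a ∂μ
  set F := ∫ a, w a * f a ∂μ
  set G := ∫ a, w a * g a ∂μ
  set Q := ∫ a, w a * (f a * g a) ∂μ
  have hlin : ∀ p q r k : ℝ, ∫ a, w a * (p + q * f a + r * g a + k * (f a * g a)) ∂μ =
      p * P + q * F + r * G + k * Q := fun p q r k => by
    have i1 : Integrable (fun a => p * w a + q * (w a * f a)) μ :=
      (hi.const_mul p).add (hf.const_mul q)
    have i2 : Integrable (fun a => p * w a + q * (w a * f a) + r * (w a * g a)) μ :=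
      i1.add (hg.const_mul r)
    rw [show (fun a => w a * (p + q * f a + r * g a + k * (f a * g a))) = fun a =>
      p * w a + q * (w a * f a) + r * (w a * g a) + k * (w a * (f a * g a)) from
        funext fun a => by ring, integral_add i2 (hfg'.const_mul k),
      integral_add i1 (hg.const_mul r), integral_add (hi.const_mul p) (hf.const_mul q)]
    simp only [integral_const_mul, P, F, G, Q]
  have h1 : ∀ b, 0 ≤ f b * g b * P + -g b * F + -f b * G + 1 * Q := fun b => by
    rw [← hlin]
    refine integral_nonneg fun a => mul_nonneg (hw a) ?_
    linarith [hfg a b]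
  have h2 : 0 ≤ Q * P + -G * F + -F * G + P * Q := by
    rw [← hlin]
    refine integral_nonneg fun b => mul_nonneg (hw b) ?_
    linarith [h1 b]
  linarith

lemma hermiteModulus_mul_le {ν : ℝ} (hν : 0 < ν) {s t : ℝ} (hst : s ^ 2 ≤ t ^ 2) :
    hermiteModulus ν 0 s * hermiteModulus (2 * ν) 0 t ≤
      hermiteModulus ν 0 t * hermiteModulus (2 * ν) 0 s := by
  set w : ℝ → ℝ := fun u => Real.exp (-(0 ^ 2 / u ^ 2) - s ^ 2 / (1 + u ^ 2)) *
    ((2 + 4 * u ^ 2) ^ (-ν) * (√(1 + u ^ 2))⁻¹) with hw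
  set f : ℝ → ℝ := fun u => Real.exp (-((t ^ 2 - s ^ 2) / (1 + u ^ 2))) with hf
  set g : ℝ → ℝ := fun u => -(2 + 4 * u ^ 2) ^ (-ν) with hg
  have e1 : (fun u => w u * f u) = fun u : ℝ =>
      Real.exp (-(0 ^ 2 / u ^ 2) - t ^ 2 / (1 + u ^ 2)) *
        ((2 + 4 * u ^ 2) ^ (-ν) * (√(1 + u ^ 2))⁻¹) := by
    funext u
    simp only [hw, hf]
    rw [mul_right_comm, ← Real.exp_add]
    congr 2
    ring
  have e2 : ∀ r u : ℝ, Real.exp (-(0 ^ 2 / u ^ 2) - r ^ 2 / (1 + u ^ 2)) *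
        ((2 + 4 * u ^ 2) ^ (-ν) * (√(1 + u ^ 2))⁻¹) * g u =
      -(Real.exp (-(0 ^ 2 / u ^ 2) - r ^ 2 / (1 + u ^ 2)) *
        ((2 + 4 * u ^ 2) ^ (-(2 * ν)) * (√(1 + u ^ 2))⁻¹)) := fun r u => by
    have h2 : 0 < 2 + 4 * u ^ 2 := by positivity
    rw [show -(2 * ν) = -ν + -ν by ring, Real.rpow_add h2]
    simp only [hg]
    ring
  have e3 : (fun u => w u * g u) = fun u : ℝ =>
      -(Real.exp (-(0 ^ 2 / u ^ 2) - s ^ 2 / (1 + u ^ 2)) *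
        ((2 + 4 * u ^ 2) ^ (-(2 * ν)) * (√(1 + u ^ 2))⁻¹)) := funext (e2 s)
  have e4 : (fun u => w u * (f u * g u)) = fun u : ℝ =>
      -(Real.exp (-(0 ^ 2 / u ^ 2) - t ^ 2 / (1 + u ^ 2)) *
        ((2 + 4 * u ^ 2) ^ (-(2 * ν)) * (√(1 + u ^ 2))⁻¹)) := by
    funext u
    rw [← mul_assoc, congrFun e1 u, e2]
  have hmono : ∀ a b : ℝ, a ^ 2 ≤ b ^ 2 → f a ≤ f b ∧ g a ≤ g b := fun a b hab => by
    constructor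
    · refine Real.exp_le_exp.2 (neg_le_neg ?_)
      exact div_le_div_of_nonneg_left (by linarith) (by positivity) (by linarith)
    · refine neg_le_neg ?_
      exact Real.rpow_le_rpow_of_nonpos (by positivity) (by linarith) (by linarith)
  have h := integral_mul_integral_le_of_monovary (μ := volume.restrict (Ioi 0)) (w := w)
    (f := f) (g := g) (fun a b => ?_) (fun u => by simp only [hw]; positivity)
    (integrableOn_hermiteModulus hν 0 s)
    (by rw [e1]; exact integrableOn_hermiteModulus hν 0 t)
    (by rw [e3]; exact (integrableOn_hermiteModulus (by linarith) 0 s).neg)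
    (by rw [e4]; exact (integrableOn_hermiteModulus (by linarith) 0 t).neg)
  · rw [e1, e3, e4, integral_neg, integral_neg, mul_neg, mul_neg, neg_le_neg_iff] at h
    exact h
  · rcases le_total (a ^ 2) (b ^ 2) with hab | hab
    · obtain ⟨h1, h2⟩ := hmono a b hab
      exact mul_nonneg_of_nonpos_of_nonpos (by linarith) (by linarith)
    · obtain ⟨h1, h2⟩ := hmono b a hab
      exact mul_nonneg (by linarith) (by linarith)

lemma integrable_div_add_sq_pow {ω : ℝ → ℝ} (hω : Integrable ω) (n : ℕ) {z : ℝ} (hz : 0 < z) :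
    Integrable fun s => ω s / (z + s ^ 2) ^ n := by
  refine (hω.norm.const_mul ((z ^ n)⁻¹)).mono' ?_ (.of_forall fun s => ?_)
  · simp_rw [div_eq_mul_inv]
    exact hω.aestronglyMeasurable.mul (Measurable.aestronglyMeasurable (by fun_prop))
  · have h : z ^ n ≤ (z + s ^ 2) ^ n :=
      pow_le_pow_left₀ hz.le (by nlinarith [sq_nonneg s]) n
    rw [norm_div, Real.norm_of_nonneg (by positivity : 0 ≤ (z + s ^ 2) ^ n), div_eq_inv_mul]
    exact mul_le_mul_of_nonneg_right (inv_anti₀ (by positivity) h) (norm_nonneg _)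

lemma hasDerivAt_integral_div_add_sq_pow {ω : ℝ → ℝ} (hω : Integrable ω) (n : ℕ) {z : ℝ}
    (hz : 0 < z) :
    HasDerivAt (fun z : ℝ => ∫ s, ω s / (z + s ^ 2) ^ (n + 1))
      (-(n + 1 : ℝ) * ∫ s, ω s / (z + s ^ 2) ^ (n + 2)) z := by
  have hz2 : 0 < z / 2 := by positivity
  have key := (hasDerivAt_integral_of_dominated_loc_of_deriv_le
    (F := fun (z : ℝ) s => ω s / (z + s ^ 2) ^ (n + 1))
    (F' := fun (z : ℝ) s => -(n + 1 : ℝ) * (ω s / (z + s ^ 2) ^ (n + 2)))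
    (bound := fun s => (n + 1 : ℝ) * (((z / 2) ^ (n + 2))⁻¹ * ‖ω s‖))
    (Ioi_mem_nhds (half_lt_self hz)) ?_ (integrable_div_add_sq_pow hω (n + 1) hz)
    ((integrable_div_add_sq_pow hω (n + 2) hz).const_mul _).aestronglyMeasurable ?_
    ((hω.norm.const_mul _).const_mul _) ?_).2
  · rw [integral_const_mul] at key
    exact key
  · filter_upwards [Ioi_mem_nhds hz] with x hx
    exact (integrable_div_add_sq_pow hω (n + 1) hx).aestronglyMeasurable
  · refine .of_forall fun s x hx => ?_
    have hx' : z / 2 < x := hx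
    have hx0 : 0 < x + s ^ 2 := by nlinarith [sq_nonneg s]
    have h : (z / 2) ^ (n + 2) ≤ (x + s ^ 2) ^ (n + 2) :=
      pow_le_pow_left₀ hz2.le (by nlinarith [sq_nonneg s]) _
    rw [norm_mul, norm_neg, norm_div, Real.norm_of_nonneg (by positivity : 0 ≤ (n + 1 : ℝ)),
      Real.norm_of_nonneg (by positivity : 0 ≤ (x + s ^ 2) ^ (n + 2)), div_eq_inv_mul]
    exact mul_le_mul_of_nonneg_left (mul_le_mul_of_nonneg_right
      (inv_anti₀ (by positivity) h) (norm_nonneg _)) (by positivity)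
  · refine .of_forall fun s x hx => ?_
    have hx' : z / 2 < x := hx
    have hx0 : 0 < x + s ^ 2 := by nlinarith [sq_nonneg s]
    have h1 := ((hasDerivAt_id x).add_const (s ^ 2)).pow (n + 1)
    have h2 := (h1.inv (by simp only [Pi.pow_apply, id]; positivity)).const_mul (ω s)
    refine h2.congr_deriv ?_
    simp only [Pi.pow_apply, id]
    push_cast
    field_simp
    ring

lemma iteratedDeriv_eq_of_stieltjes {ω D : ℝ → ℝ} (hω : Integrable ω) {C : ℝ}
    (hD : ∀ z, 0 < z → D z = C * ∫ s, ω s / (z + s ^ 2)) (n : ℕ) :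
    ∀ z, 0 < z → iteratedDeriv n D z =
      C * ((-1) ^ n * n.factorial * ∫ s, ω s / (z + s ^ 2) ^ (n + 1)) := by
  induction n with
  | zero => intro z hz; simpa using hD z hz
  | succ n ih =>
    intro z hz
    have he : iteratedDeriv n D =ᶠ[nhds z] fun z =>
        C * ((-1) ^ n * n.factorial * ∫ s, ω s / (z + s ^ 2) ^ (n + 1)) := by
      filter_upwards [Ioi_mem_nhds hz] with x hx using ih x hx
    rw [iteratedDeriv_succ, he.deriv_eq,
      (((hasDerivAt_integral_div_add_sq_pow hω n hz).const_mul _).const_mul _).deriv,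
      Nat.factorial_succ]
    push_cast
    ring

lemma integral_hermiteDensity_difference_nonneg {ν : ℝ} (hν : 0 < ν) {z : ℝ} (hz : 0 < z)
    (n : ℕ) :
    0 ≤ ∫ s : ℝ, (2 * (hermiteRatio ν (s * Complex.I)).re -
      (hermiteRatio (2 * ν) (s * Complex.I)).re) / (z + s ^ 2) ^ n := by
  have hν' : 0 < 2 * ν := by linarith
  set ω : ℝ → ℝ := fun s => 2 * (hermiteRatio ν (s * Complex.I)).re -
      (hermiteRatio (2 * ν) (s * Complex.I)).re with hω
  have i1 := integrable_re_hermiteRatio hν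
  have i2 := integrable_re_hermiteRatio hν'
  have hωi : Integrable ω := (i1.const_mul 2).sub i2
  have hω0 : ∫ s, ω s = 0 := by
    rw [hω, integral_sub (i1.const_mul 2) i2, integral_const_mul, integral_re_hermiteRatio hν,
      integral_re_hermiteRatio hν']
    ring
  obtain ⟨a, ha, hae⟩ := exists_re_hermiteRatio_eq hν
  obtain ⟨b, hb, hbe⟩ := exists_re_hermiteRatio_eq hν'
  set f : ℝ → ℝ := fun s => 2 * a - b * (hermiteModulus ν 0 s / hermiteModulus (2 * ν) 0 s)
    with hf
  have hωf : ∀ s, hermiteDensity ν s * f s = ω s := fun s => by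
    have p1 := hermiteModulus_pos hν 0 s
    have p2 := hermiteModulus_pos hν' 0 s
    simp only [hω, hf, hae, hbe, hermiteDensity]
    field_simp
  have hmono : ∀ s t : ℝ, s ^ 2 ≤ t ^ 2 →
      f t ≤ f s ∧ ((z + t ^ 2) ^ n)⁻¹ ≤ ((z + s ^ 2) ^ n)⁻¹ := fun s t hst => by
    constructor
    · refine sub_le_sub_left (mul_le_mul_of_nonneg_left ?_ hb.le) _
      rw [div_le_div_iff₀ (hermiteModulus_pos hν' 0 s) (hermiteModulus_pos hν' 0 t)]
      exact hermiteModulus_mul_le hν hst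
    · exact inv_anti₀ (by positivity) (pow_le_pow_left₀ (by positivity) (by linarith) n)
  have h := integral_mul_integral_le_of_monovary (μ := volume) (w := hermiteDensity ν) (f := f)
    (g := fun s => ((z + s ^ 2) ^ n)⁻¹) (fun s t => ?_) (fun s => (hermiteDensity_pos hν s).le)
    (integrable_hermiteDensity hν) (by simpa only [hωf] using hωi)
    (by simpa only [div_eq_mul_inv] using
      integrable_div_add_sq_pow (integrable_hermiteDensity hν) n hz)
    (by simpa only [← mul_assoc, hωf, div_eq_mul_inv] using integrable_div_add_sq_pow hωi n hz)
  · simp only [← mul_assoc, hωf, hω0, zero_mul] at h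
    simp only [← div_eq_mul_inv] at h
    refine nonneg_of_mul_nonneg_right h ?_
    refine (integral_pos_iff_support_of_nonneg (fun s => (hermiteDensity_pos hν s).le)
      (integrable_hermiteDensity hν)).2 ?_
    rw [show Function.support (hermiteDensity ν) = univ from
      eq_univ_of_forall fun s => (hermiteDensity_pos hν s).ne']
    simp
  · rcases le_total (s ^ 2) (t ^ 2) with hst | hst
    · obtain ⟨h1, h2⟩ := hmono s t hst
      exact mul_nonneg (by linarith) (by linarith)
    · obtain ⟨h1, h2⟩ := hmono t s hst
      exact mul_nonneg_of_nonpos_of_nonpos (by linarith) (by linarith)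

lemma HermiteNeg_eq (ν x : ℝ) :
    HermiteNeg ν x = (1 / Real.Gamma ν) * (hermiteIntegral ν x).re := by
  rw [HermiteNeg, hermiteIntegral_ofReal, Complex.ofReal_re]

lemma HermiteNeg_pos {ν : ℝ} (hν : 0 < ν) (x : ℝ) : 0 < HermiteNeg ν x := by
  have := Real.Gamma_pos_of_pos hν
  have := hermiteIntegral_ofReal_re_pos hν x
  rw [HermiteNeg_eq]
  positivity

lemma hasDerivAt_log_HermiteNeg_sqrt {ν z : ℝ} (hν : 0 < ν) (hz : 0 < z) :
    HasDerivAt (fun v => Real.log (HermiteNeg ν (√v)))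
      (-(1 / Real.pi * ∫ s : ℝ, (hermiteRatio ν (s * Complex.I)).re / (z + s ^ 2))) z := by
  have hs : 0 < √z := Real.sqrt_pos.2 hz
  have hΓ := Real.Gamma_pos_of_pos hν
  have p0 := hermiteIntegral_ofReal_re_pos hν (√z)
  have h1 : HasDerivAt (fun x : ℝ => (hermiteIntegral ν x).re)
      (-2 * (hermiteIntegral (ν + 1) (√z : ℝ)).re) (√z) :=
    ((hasDerivAt_hermiteIntegral hν (√z : ℝ)).real_of_complex).congr_deriv (by simp)
  have h2 : HasDerivAt (fun v => HermiteNeg ν (√v)) _ z :=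
    ((h1.const_mul (1 / Real.Gamma ν)).comp z (Real.hasDerivAt_sqrt hz.ne')).congr_of_eventuallyEq
      (.of_forall fun v => HermiteNeg_eq ν (√v))
  refine (h2.log (HermiteNeg_pos hν _).ne').congr_deriv ?_
  have h3 := integral_re_hermiteRatio_div hν hs
  rw [Real.sq_sqrt hz.le] at h3
  rw [h3, hermiteRatio_ofReal, Complex.ofReal_re, HermiteNeg_eq]
  field_simp

/-- Corollary: for every `ν ∈ (0,2]`, `z ↦ (H_{-ν}(√z))² / H_{-2ν}(√z)` is
logarithmically completely monotone on `(0,∞)`. -/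
theorem Hermite_ratio_LCM (ν : ℝ) (hν : 0 < ν) (hν2 : ν ≤ 2) :
    ∀ n : ℕ, ∀ z : ℝ, 0 < z →
      0 ≤ (-1 : ℝ) ^ n *
        iteratedDeriv n
          (fun w => -deriv
            (fun v => Real.log
              ((HermiteNeg ν (Real.sqrt v)) ^ 2 / HermiteNeg (2 * ν) (Real.sqrt v))) w) z := by
  intro n z hz
  have hν' : 0 < 2 * ν := by linarith
  have i1 := integrable_re_hermiteRatio hν
  have i2 := integrable_re_hermiteRatio hν'
  have hD : ∀ w, 0 < w → -deriv (fun v => Real.log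
      ((HermiteNeg ν (Real.sqrt v)) ^ 2 / HermiteNeg (2 * ν) (Real.sqrt v))) w =
      1 / Real.pi * ∫ s : ℝ, (2 * (hermiteRatio ν (s * Complex.I)).re -
        (hermiteRatio (2 * ν) (s * Complex.I)).re) / (w + s ^ 2) := fun w hw => by
    have e : (fun v => Real.log
        ((HermiteNeg ν (Real.sqrt v)) ^ 2 / HermiteNeg (2 * ν) (Real.sqrt v))) = fun v =>
        2 * Real.log (HermiteNeg ν (√v)) - Real.log (HermiteNeg (2 * ν) (√v)) := by
      funext v
      rw [Real.log_div (pow_ne_zero _ (HermiteNeg_pos hν _).ne') (HermiteNeg_pos hν' _).ne',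
        Real.log_pow]
      norm_num
    have j1 : Integrable fun s : ℝ => (hermiteRatio ν (s * Complex.I)).re / (w + s ^ 2) := by
      simpa using integrable_div_add_sq_pow i1 1 hw
    have j2 : Integrable fun s : ℝ =>
        (hermiteRatio (2 * ν) (s * Complex.I)).re / (w + s ^ 2) := by
      simpa using integrable_div_add_sq_pow i2 1 hw
    have hd := ((hasDerivAt_log_HermiteNeg_sqrt hν hw).const_mul 2).fun_sub
      (hasDerivAt_log_HermiteNeg_sqrt hν' hw)
    rw [e, hd.deriv]
    simp_rw [sub_div, mul_div_assoc]
    rw [integral_sub (j1.const_mul 2) j2, integral_const_mul]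
    ring
  rw [iteratedDeriv_eq_of_stieltjes ((i1.const_mul 2).sub i2) hD n z hz]
  have hpos := integral_hermiteDensity_difference_nonneg hν hz (n + 1)
  have hsign : (-1 : ℝ) ^ n * (-1) ^ n = 1 := by rw [← mul_pow]; simp
  have hfac : (0 : ℝ) ≤ n.factorial := Nat.cast_nonneg _
  have hpi := Real.pi_pos
  calc (0 : ℝ) ≤ 1 / Real.pi * n.factorial * _ := mul_nonneg (by positivity) hpos
    _ = ((-1) ^ n * (-1) ^ n) * (1 / Real.pi * n.factorial * _) := by rw [hsign, one_mul]
    _ = _ := by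
      simp only [Pi.sub_apply]
      ring
end

section
/- The function z ↦ (K₀(z))² / E₁(2z) is completely monotone on (0,∞), where K₀(z) = ∫₀^∞ e^{−z cosh t} dt is the Macdonald (modified Bessel) function of order zero and E₁(z) = ∫_z^∞ e^{−t} t^{−1} dt is the exponential integral. -/
open MeasureTheory Set

/-- The Macdonald (modified Bessel) function of order zero. -/
noncomputable def K0 (z : ℝ) : ℝ := ∫ t in Ioi (0 : ℝ), Real.exp (-z * Real.cosh t)

/-- The exponential integral. -/
noncomputable def E1 (z : ℝ) : ℝ := ∫ t in Ioi z, Real.exp (-t) / t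

open Filter Topology

/-- A renewal-type deconvolution inequality: if `a = c ⋆ b` with `b` positive and log-convex and
`a / b` nonnegative and nondecreasing, then `c` is nonnegative. -/
theorem nonneg_of_cauchyProduct_eq {a b c : ℕ → ℝ} (hb : ∀ n, 0 < b n)
    (hlog : ∀ n, b (n + 1) * b (n + 1) ≤ b (n + 2) * b n)
    (ha : 0 ≤ a 0) (hab : ∀ n, a n * b (n + 1) ≤ a (n + 1) * b n)
    (hconv : ∀ n, a n = ∑ i ∈ Finset.range (n + 1), c i * b (n - i)) (n : ℕ) : 0 ≤ c n := by
  have hratio : Monotone fun m => b (m + 1) / b m :=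
    monotone_nat_of_le_succ fun m => by
      rw [div_le_div_iff₀ (hb _) (hb _)]
      exact hlog m
  induction n using Nat.strong_induction_on with
  | _ n ih =>
    cases n with
    | zero =>
      have h := hconv 0
      simp only [zero_add, Finset.range_one, Finset.sum_singleton, Nat.sub_self] at h
      exact nonneg_of_mul_nonneg_left (h ▸ ha) (hb 0)
    | succ n =>
      have hsum : (∑ i ∈ Finset.range (n + 1), c i * b (n + 1 - i)) * b n ≤ a n * b (n + 1) := by
        rw [hconv n, Finset.sum_mul, Finset.sum_mul]
        refine Finset.sum_le_sum fun i hi => ?_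
        have hin : i ≤ n := Nat.lt_succ_iff.mp (Finset.mem_range.mp hi)
        have h := hratio (Nat.sub_le n i)
        simp only at h
        rw [div_le_div_iff₀ (hb _) (hb _)] at h
        rw [Nat.sub_add_comm hin, mul_assoc, mul_assoc, mul_comm (b (n - i)) (b (n + 1))]
        exact mul_le_mul_of_nonneg_left h (ih i (Nat.lt_succ_of_le hin))
      have hlast := hconv (n + 1)
      rw [Finset.sum_range_succ, Nat.sub_self] at hlast
      have hprod : 0 ≤ c (n + 1) * b 0 * b n := by
        have := hab n
        rw [hlast, add_mul] at this
        linarith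
      exact nonneg_of_mul_nonneg_left (nonneg_of_mul_nonneg_left hprod (hb n)) (hb 0)

/-- `s ^ n * exp (-z * s)` is integrable on `(0, ∞)`. -/
theorem integrableOn_pow_mul_exp_neg_mul (n : ℕ) {z : ℝ} (hz : 0 < z) :
    IntegrableOn (fun s : ℝ => s ^ n * Real.exp (-z * s)) (Ioi 0) := by
  have h := integrableOn_rpow_mul_exp_neg_mul_rpow (p := 1) (s := n) (b := z)
    (by have : (0 : ℝ) ≤ n := n.cast_nonneg
        linarith) one_pos hz
  simpa using h

section Laplace

variable {ρ : ℝ → ℝ} {C : ℝ}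

theorem integrableOn_pow_mul_exp_neg_mul_mul (hm : AEMeasurable ρ (volume.restrict (Ioi 0)))
    (hC : ∀ s ∈ Ioi (0 : ℝ), |ρ s| ≤ C) (n : ℕ) {z : ℝ} (hz : 0 < z) :
    IntegrableOn (fun s : ℝ => s ^ n * Real.exp (-z * s) * ρ s) (Ioi 0) :=
  (integrableOn_pow_mul_exp_neg_mul n hz).mul_bdd hm.aestronglyMeasurable
    ((ae_restrict_iff' measurableSet_Ioi).2 (ae_of_all _ hC))

/-- Integration against the measure on `(0, ∞)` with nonnegative density `ρ`. -/
theorem integral_withDensity_ofReal_Ioi (hm : AEMeasurable ρ (volume.restrict (Ioi 0)))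
    (h0 : ∀ s ∈ Ioi (0 : ℝ), 0 ≤ ρ s) (f : ℝ → ℝ) :
    ∫ s, f s ∂((volume.restrict (Ioi 0)).withDensity fun s => ENNReal.ofReal (ρ s)) =
      ∫ s in Ioi (0 : ℝ), f s * ρ s := by
  rw [integral_withDensity_eq_integral_toReal_smul₀ hm.ennreal_ofReal
    (ae_of_all _ fun _ => ENNReal.ofReal_lt_top)]
  refine setIntegral_congr_fun measurableSet_Ioi fun s hs => ?_
  simp only [smul_eq_mul, ENNReal.toReal_ofReal (h0 s hs), mul_comm]

/-- The Laplace transform of a bounded nonnegative density is analytic on `(0, ∞)`, and its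
derivatives are obtained by differentiating under the integral. -/
theorem analyticAt_laplace_and_iteratedDeriv (hm : AEMeasurable ρ (volume.restrict (Ioi 0)))
    (h0 : ∀ s ∈ Ioi (0 : ℝ), 0 ≤ ρ s) (hC : ∀ s ∈ Ioi (0 : ℝ), |ρ s| ≤ C) {z : ℝ} (hz : 0 < z) :
    AnalyticAt ℝ (fun w => ∫ s in Ioi (0 : ℝ), Real.exp (-w * s) * ρ s) z ∧
    ∀ n : ℕ, (-1) ^ n * iteratedDeriv n (fun w => ∫ s in Ioi (0 : ℝ), Real.exp (-w * s) * ρ s) z =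
      ∫ s in Ioi (0 : ℝ), s ^ n * Real.exp (-z * s) * ρ s := by
  set μ := (volume.restrict (Ioi 0)).withDensity fun s => ENNReal.ofReal (ρ s) with hμ
  have hmgf : (fun w => ∫ s in Ioi (0 : ℝ), Real.exp (-w * s) * ρ s) =
      ProbabilityTheory.mgf (fun s : ℝ => -s) μ := by
    funext w
    rw [ProbabilityTheory.mgf, hμ, integral_withDensity_ofReal_Ioi hm h0]
    simp
  have hint : Ioi (0 : ℝ) ⊆ ProbabilityTheory.integrableExpSet (fun s : ℝ => -s) μ := by
    intro w hw
    rw [ProbabilityTheory.integrableExpSet, mem_ofPred_eq, hμ,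
      integrable_withDensity_iff_integrable_smul₀' hm.ennreal_ofReal
        (ae_of_all _ fun _ => ENNReal.ofReal_lt_top)]
    refine (integrableOn_pow_mul_exp_neg_mul_mul hm hC 0 hw).congr_fun (fun s hs => ?_)
      measurableSet_Ioi
    simp [ENNReal.toReal_ofReal (h0 s hs), mul_comm]
  have hmem : z ∈ interior (ProbabilityTheory.integrableExpSet (fun s : ℝ => -s) μ) :=
    interior_maximal hint isOpen_Ioi hz
  rw [hmgf]
  refine ⟨ProbabilityTheory.analyticAt_mgf hmem, fun n => ?_⟩
  rw [ProbabilityTheory.iteratedDeriv_mgf hmem n, hμ, integral_withDensity_ofReal_Ioi hm h0,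
    ← integral_const_mul]
  refine setIntegral_congr_fun measurableSet_Ioi fun s _ => ?_
  have : (-1 : ℝ) ^ n * (-s) ^ n = s ^ n := by rw [← mul_pow]; simp
  simp only [← this, mul_neg, neg_mul]
  ring

end Laplace

/-- Chebyshev's association inequality for the weight `p` on `(0, ∞)`. -/
theorem chebyshev_Ioi {p φ : ℝ → ℝ} (hφ : MonotoneOn φ (Ioi 0))
    (hp : ∀ s ∈ Ioi (0 : ℝ), 0 ≤ p s) (hp0 : IntegrableOn p (Ioi 0))
    (hp1 : IntegrableOn (fun s => s * p s) (Ioi 0))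
    (hq0 : IntegrableOn (fun s => p s * φ s) (Ioi 0))
    (hq1 : IntegrableOn (fun s => s * p s * φ s) (Ioi 0))
    (hpos0 : 0 < ∫ s in Ioi (0 : ℝ), p s) (hpos1 : 0 < ∫ s in Ioi (0 : ℝ), s * p s) :
    (∫ s in Ioi (0 : ℝ), p s * φ s) * ∫ s in Ioi (0 : ℝ), s * p s ≤
      (∫ s in Ioi (0 : ℝ), s * p s * φ s) * ∫ s in Ioi (0 : ℝ), p s := by
  set m := (∫ s in Ioi (0 : ℝ), s * p s) / ∫ s in Ioi (0 : ℝ), p s with hm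
  have hmpos : 0 < m := div_pos hpos1 hpos0
  have hmeq : (∫ s in Ioi (0 : ℝ), s * p s) = m * ∫ s in Ioi (0 : ℝ), p s := by
    rw [hm, div_mul_cancel₀ _ hpos0.ne']
  have hnn : 0 ≤ ∫ s in Ioi (0 : ℝ), (s - m) * (φ s - φ m) * p s := by
    refine setIntegral_nonneg measurableSet_Ioi fun s hs => mul_nonneg ?_ (hp s hs)
    rcases le_total s m with h | h
    · exact mul_nonneg_of_nonpos_of_nonpos (sub_nonpos.2 h) (sub_nonpos.2 (hφ hs hmpos h))
    · exact mul_nonneg (sub_nonneg.2 h) (sub_nonneg.2 (hφ hmpos hs h))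
  have hexp : ∫ s in Ioi (0 : ℝ), (s - m) * (φ s - φ m) * p s =
      ((∫ s in Ioi (0 : ℝ), s * p s * φ s) - m * ∫ s in Ioi (0 : ℝ), p s * φ s) -
      φ m * ((∫ s in Ioi (0 : ℝ), s * p s) - m * ∫ s in Ioi (0 : ℝ), p s) := by
    rw [← integral_const_mul, ← integral_const_mul, ← integral_sub hq1 (hq0.const_mul m),
      ← integral_sub hp1 (hp0.const_mul m), ← integral_const_mul, ← integral_sub]
    · congr 1
      ext s
      ring
    · exact hq1.sub (hq0.const_mul m)
    · exact (hp1.sub (hp0.const_mul m)).const_mul _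
  rw [hexp, hmeq, sub_self, mul_zero, sub_zero, sub_nonneg] at hnn
  rw [hmeq]
  calc _ = (m * ∫ s in Ioi (0 : ℝ), p s * φ s) * ∫ s in Ioi (0 : ℝ), p s := by ring
    _ ≤ _ := mul_le_mul_of_nonneg_right hnn hpos0.le

theorem aemeasurable_inv_add_two :
    AEMeasurable (fun s : ℝ => (s + 2)⁻¹) (volume.restrict (Ioi 0)) :=
  (by fun_prop : Measurable fun s : ℝ => (s + 2)⁻¹).aemeasurable

theorem abs_inv_add_two_le {s : ℝ} (hs : s ∈ Ioi (0 : ℝ)) : |(s + 2)⁻¹| ≤ 1 := by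
  have hs : 0 < s := hs
  rw [abs_of_pos (by positivity)]
  exact inv_le_one_of_one_le₀ (by linarith)

theorem integrableOn_pow_mul_exp_mul_inv (n : ℕ) {z : ℝ} (hz : 0 < z) :
    IntegrableOn (fun s : ℝ => s ^ n * Real.exp (-z * s) * (s + 2)⁻¹) (Ioi 0) :=
  integrableOn_pow_mul_exp_neg_mul_mul aemeasurable_inv_add_two
    (fun _ => abs_inv_add_two_le) n hz

theorem integrableOn_pow_mul_exp_mul_inv_sq (n : ℕ) {z : ℝ} (hz : 0 < z) :
    IntegrableOn (fun s : ℝ => s ^ n * Real.exp (-z * s) * (s + 2)⁻¹ * (s + 2)⁻¹) (Ioi 0) := by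
  have h := integrableOn_pow_mul_exp_neg_mul_mul (ρ := fun s => (s + 2)⁻¹ * (s + 2)⁻¹) (C := 1)
    (aemeasurable_inv_add_two.mul aemeasurable_inv_add_two)
    (fun s hs => by
      rw [abs_mul]
      exact mul_le_one₀ (abs_inv_add_two_le hs) (abs_nonneg _) (abs_inv_add_two_le hs)) n hz
  simpa only [mul_assoc] using h

/-- The moment `∫₀^∞ sⁿ e^{-zs} / (s + 2) ds`. -/
noncomputable def invMoment (n : ℕ) (z : ℝ) : ℝ :=
  ∫ s in Ioi (0 : ℝ), s ^ n * Real.exp (-z * s) * (s + 2)⁻¹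

theorem invMoment_def (n : ℕ) (z : ℝ) :
    invMoment n z = ∫ s in Ioi (0 : ℝ), s ^ n * Real.exp (-z * s) * (s + 2)⁻¹ := rfl

theorem invMoment_pos (n : ℕ) {z : ℝ} (hz : 0 < z) : 0 < invMoment n z := by
  rw [invMoment, setIntegral_pos_iff_support_of_nonneg_ae _ (integrableOn_pow_mul_exp_mul_inv n hz)]
  · have hsub : Ioi (0 : ℝ) ⊆
        (Function.support fun s : ℝ => s ^ n * Real.exp (-z * s) * (s + 2)⁻¹) := by
      intro s hs
      have hs : 0 < s := hs
      exact ne_of_gt (by positivity)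
    rw [inter_eq_self_of_subset_right hsub]
    simp
  · refine (ae_restrict_iff' measurableSet_Ioi).2 (ae_of_all _ fun s hs => ?_)
    have hs : 0 < s := hs
    simp only [Pi.zero_apply]
    positivity

/-- Integration by parts for the moments of `e^{-zs} / (s + 2)`. -/
theorem succ_mul_invMoment (n : ℕ) {z : ℝ} (hz : 0 < z) :
    (n + 1) * invMoment n z = z * invMoment (n + 1) z +
      ∫ s in Ioi (0 : ℝ), s ^ (n + 1) * Real.exp (-z * s) * (s + 2)⁻¹ * (s + 2)⁻¹ := by
  have h0 := (integrableOn_pow_mul_exp_mul_inv n hz).const_mul (n + 1 : ℝ)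
  have h1 := (integrableOn_pow_mul_exp_mul_inv (n + 1) hz).const_mul z
  have h2 := integrableOn_pow_mul_exp_mul_inv_sq (n + 1) hz
  have hderiv : ∀ s ∈ Ici (0 : ℝ),
      HasDerivAt (fun s : ℝ => s ^ (n + 1) * Real.exp (-z * s) * (s + 2)⁻¹)
        ((n + 1) * (s ^ n * Real.exp (-z * s) * (s + 2)⁻¹) -
          z * (s ^ (n + 1) * Real.exp (-z * s) * (s + 2)⁻¹) -
          s ^ (n + 1) * Real.exp (-z * s) * (s + 2)⁻¹ * (s + 2)⁻¹) s := by
    intro s hs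
    have hs : 0 ≤ s := hs
    have hs2 : s + 2 ≠ 0 := by positivity
    have he : HasDerivAt (fun s : ℝ => Real.exp (-z * s)) (Real.exp (-z * s) * (-z)) s := by
      simpa using ((hasDerivAt_id s).const_mul (-z)).exp
    have hi : HasDerivAt (fun s : ℝ => (s + 2)⁻¹) (-1 / (s + 2) ^ 2) s :=
      ((hasDerivAt_id s).add_const 2).fun_inv hs2
    convert! ((hasDerivAt_pow (n + 1) s).mul he).mul hi using 1
    simp only [Pi.mul_apply, Nat.add_sub_cancel, Nat.cast_add, Nat.cast_one]
    field_simp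
    ring
  have hlim : Tendsto (fun s : ℝ => s ^ (n + 1) * Real.exp (-z * s) * (s + 2)⁻¹) atTop (𝓝 0) := by
    have ha : Tendsto (fun s : ℝ => s ^ (n + 1) * Real.exp (-z * s)) atTop (𝓝 0) := by
      have := tendsto_rpow_mul_exp_neg_mul_atTop_nhds_zero (n + 1 : ℕ) z hz
      simpa only [Real.rpow_natCast] using this
    have hb : Tendsto (fun s : ℝ => (s + 2)⁻¹) atTop (𝓝 0) :=
      tendsto_inv_atTop_zero.comp (tendsto_atTop_add_const_right _ _ tendsto_id)
    simpa using ha.mul hb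
  have h := integral_Ioi_of_hasDerivAt_of_tendsto' hderiv ((h0.sub h1).sub h2) hlim
  rw [integral_sub (f := fun s => (n + 1) * (s ^ n * Real.exp (-z * s) * (s + 2)⁻¹) -
      z * (s ^ (n + 1) * Real.exp (-z * s) * (s + 2)⁻¹)) (h0.sub h1) h2, integral_sub h0 h1,
    integral_const_mul, integral_const_mul, ← invMoment_def, ← invMoment_def,
    zero_pow n.succ_ne_zero] at h
  linarith

/-- The normalized moments `invMoment n z / n!` form a log-convex sequence. -/
theorem invMoment_log_convex (n : ℕ) {z : ℝ} (hz : 0 < z) :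
    (n + 2) * (invMoment (n + 1) z * invMoment (n + 1) z) ≤
      (n + 1) * (invMoment (n + 2) z * invMoment n z) := by
  have e0 := succ_mul_invMoment n hz
  have e1 := succ_mul_invMoment (n + 1) hz
  have hshift : ∀ k : ℕ, (fun s : ℝ => s * (s ^ k * Real.exp (-z * s) * (s + 2)⁻¹)) =
      fun s : ℝ => s ^ (k + 1) * Real.exp (-z * s) * (s + 2)⁻¹ := fun k => by
    funext s
    ring
  have hshift' : ∀ s : ℝ, s * (s ^ (n + 1) * Real.exp (-z * s) * (s + 2)⁻¹) =
      s ^ (n + 1 + 1) * Real.exp (-z * s) * (s + 2)⁻¹ := congrFun (hshift (n + 1))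
  have hcheb := chebyshev_Ioi (p := fun s => s ^ (n + 1) * Real.exp (-z * s) * (s + 2)⁻¹)
    (φ := fun s => -(s + 2)⁻¹)
    (fun x hx y _ hxy => by
      have hx : 0 < x := hx
      exact neg_le_neg (inv_anti₀ (by positivity) (by linarith)))
    (fun s hs => by
      have hs : 0 < s := hs
      positivity)
    (integrableOn_pow_mul_exp_mul_inv (n + 1) hz)
    (by simpa only [hshift'] using integrableOn_pow_mul_exp_mul_inv (n + 1 + 1) hz)
    (by simpa only [mul_neg, Pi.neg_def] using (integrableOn_pow_mul_exp_mul_inv_sq (n + 1) hz).neg)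
    (by simpa only [hshift', mul_neg, Pi.neg_def] using
      (integrableOn_pow_mul_exp_mul_inv_sq (n + 1 + 1) hz).neg)
    (invMoment_pos (n + 1) hz)
    (by simpa only [hshift', invMoment_def] using invMoment_pos (n + 1 + 1) hz)
  simp only [hshift', mul_neg, integral_neg] at hcheb
  simp only [← invMoment_def] at hcheb
  push_cast at e1
  rw [show n + 1 + 1 = n + 2 from rfl] at *
  linear_combination hcheb + invMoment (n + 1) z * e1 - invMoment (n + 2) z * e0

/-- If `φ` is nonnegative and nondecreasing, then the quotient of the Laplace transforms of
`φ(s) / (s + 2)` and `1 / (s + 2)` is completely monotone. -/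
theorem laplace_quotient_completelyMonotone {φ : ℝ → ℝ} {C : ℝ} (hφ : MonotoneOn φ (Ioi 0))
    (h0 : ∀ s ∈ Ioi (0 : ℝ), 0 ≤ φ s) (hC : ∀ s ∈ Ioi (0 : ℝ), φ s * (s + 2)⁻¹ ≤ C)
    (n : ℕ) {z : ℝ} (hz : 0 < z) :
    0 ≤ (-1 : ℝ) ^ n * iteratedDeriv n
      (fun w => (∫ s in Ioi (0 : ℝ), Real.exp (-w * s) * ((s + 2)⁻¹ * φ s)) /
        ∫ s in Ioi (0 : ℝ), Real.exp (-w * s) * (s + 2)⁻¹) z := by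
  have hm : AEMeasurable (fun s => (s + 2)⁻¹ * φ s) (volume.restrict (Ioi 0)) :=
    aemeasurable_inv_add_two.mul (aemeasurable_restrict_of_monotoneOn measurableSet_Ioi hφ)
  have hnn : ∀ s ∈ Ioi (0 : ℝ), 0 ≤ (s + 2)⁻¹ * φ s := fun s hs => by
    have hs' : 0 < s := hs
    exact mul_nonneg (by positivity) (h0 s hs)
  have hbd : ∀ s ∈ Ioi (0 : ℝ), |(s + 2)⁻¹ * φ s| ≤ C := fun s hs => by
    rw [abs_of_nonneg (hnn s hs), mul_comm]
    exact hC s hs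
  have hint : ∀ k : ℕ,
      IntegrableOn (fun s : ℝ => s ^ k * Real.exp (-z * s) * (s + 2)⁻¹ * φ s) (Ioi 0) := fun k => by
    simpa only [mul_assoc] using integrableOn_pow_mul_exp_neg_mul_mul hm hbd k hz
  obtain ⟨hF, hFn⟩ := analyticAt_laplace_and_iteratedDeriv hm hnn hbd hz
  obtain ⟨hG, hGn⟩ := analyticAt_laplace_and_iteratedDeriv (C := 1) aemeasurable_inv_add_two
    (fun s hs => by
      have hs : 0 < s := hs
      positivity) (fun _ => abs_inv_add_two_le) hz
  set F := fun w => ∫ s in Ioi (0 : ℝ), Real.exp (-w * s) * ((s + 2)⁻¹ * φ s) with hFdef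
  set G := fun w => ∫ s in Ioi (0 : ℝ), Real.exp (-w * s) * (s + 2)⁻¹ with hGdef
  have hGpos : ∀ w, 0 < w → 0 < G w := fun w hw => by
    simpa [invMoment, hGdef] using invMoment_pos 0 hw
  have hH : AnalyticAt ℝ (fun w => F w / G w) z := hF.fun_div hG (hGpos z hz).ne'
  have hprod : F =ᶠ[𝓝 z] fun w => (F w / G w) * G w := by
    filter_upwards [Ioi_mem_nhds hz] with w hw
    rw [div_mul_cancel₀ _ (hGpos w hw).ne']
  have hfact : ∀ k : ℕ, (0 : ℝ) < k.factorial := fun k => by exact_mod_cast k.factorial_pos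
  set A : ℕ → ℝ := fun k => ∫ s in Ioi (0 : ℝ), s ^ k * Real.exp (-z * s) * ((s + 2)⁻¹ * φ s)
    with hA
  have key := nonneg_of_cauchyProduct_eq (a := fun k => A k / k.factorial)
    (b := fun k => invMoment k z / k.factorial)
    (c := fun k => (-1) ^ k * iteratedDeriv k (fun w => F w / G w) z / k.factorial)
    (fun k => div_pos (invMoment_pos k hz) (hfact k)) ?_ ?_ ?_ ?_ n
  · have h := mul_nonneg key (hfact n).le
    rwa [div_mul_cancel₀ _ (hfact n).ne'] at h
  · intro k
    have h := invMoment_log_convex k hz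
    have hk := hfact k
    simp only [Nat.factorial_succ, Nat.cast_mul, Nat.cast_add, Nat.cast_one]
    rw [div_mul_div_comm, div_mul_div_comm, div_le_div_iff₀ (by positivity) (by positivity)]
    have hk2 : (0 : ℝ) ≤ (k + 1) * k.factorial * k.factorial := by positivity
    have := mul_le_mul_of_nonneg_left h hk2
    linear_combination this
  · refine div_nonneg (setIntegral_nonneg measurableSet_Ioi fun s hs => ?_) (hfact 0).le
    have hs' : 0 < s := hs
    exact mul_nonneg (by positivity) (hnn s hs)
  · intro k
    have hshift : ∀ s : ℝ, s * (s ^ k * Real.exp (-z * s) * (s + 2)⁻¹) =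
        s ^ (k + 1) * Real.exp (-z * s) * (s + 2)⁻¹ := fun s => by ring
    have hcheb := chebyshev_Ioi (p := fun s => s ^ k * Real.exp (-z * s) * (s + 2)⁻¹) hφ
      (fun s hs => by
        have hs : 0 < s := hs
        positivity)
      (integrableOn_pow_mul_exp_mul_inv k hz)
      (by simpa only [hshift] using integrableOn_pow_mul_exp_mul_inv (k + 1) hz)
      (hint k)
      (by simpa only [hshift] using hint (k + 1))
      (invMoment_pos k hz)
      (by simpa only [hshift, invMoment_def] using invMoment_pos (k + 1) hz)
    simp only [hshift] at hcheb
    simp only [← invMoment_def] at hcheb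
    have hAk : ∀ j, A j = ∫ s in Ioi (0 : ℝ), s ^ j * Real.exp (-z * s) * (s + 2)⁻¹ * φ s :=
      fun j => by simp only [hA, mul_assoc]
    rw [← hAk, ← hAk] at hcheb
    rw [div_mul_div_comm, div_mul_div_comm, mul_comm (k.factorial : ℝ)]
    exact div_le_div_of_nonneg_right hcheb (mul_pos (hfact _) (hfact _)).le
  · intro k
    have hL := hFn k
    rw [(hprod.iteratedDeriv k).eq_of_nhds,
      iteratedDeriv_fun_mul hH.contDiffAt hG.contDiffAt, Finset.mul_sum] at hL
    simp only [hA]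
    rw [← hL, Finset.sum_div]
    refine Finset.sum_congr rfl fun i hi => ?_
    have hik : i ≤ k := Nat.lt_succ_iff.mp (Finset.mem_range.mp hi)
    rw [invMoment, ← hGn (k - i), Nat.cast_choose ℝ hik, ← Nat.add_sub_cancel' hik, pow_add,
      Nat.add_sub_cancel_left]
    have h1 := (hfact i).ne'
    have h2 := (hfact (k - i)).ne'
    have h3 := (hfact (i + (k - i))).ne'
    field_simp

/-- The Laplace density of `z ↦ e^z K₀(z)`. -/
noncomputable def besselKernel (u : ℝ) : ℝ := (√u)⁻¹ * (√(u + 2))⁻¹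

/-- The arcsine weight on `(0, 1)`. -/
noncomputable def arcsineWeight (x : ℝ) : ℝ := (√x)⁻¹ * (√(1 - x))⁻¹

/-- The ratio of the Laplace densities of `e^{2z} K₀(z)²` and `e^{2z} E₁(2z)`. -/
noncomputable def densityRatio (s : ℝ) : ℝ :=
  ∫ x in (0 : ℝ)..1, arcsineWeight x * ((s + 2) * ((√(s * x + 2))⁻¹ * (√(s * (1 - x) + 2))⁻¹))

theorem arcsineWeight_nonneg (x : ℝ) : 0 ≤ arcsineWeight x := by
  unfold arcsineWeight
  positivity

theorem intervalIntegrable_arcsineWeight : IntervalIntegrable arcsineWeight volume 0 1 := by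
  have h1 : IntervalIntegrable (fun x : ℝ => (√x)⁻¹) volume 0 1 := by
    refine (intervalIntegral.intervalIntegrable_rpow' (r := -(1 / 2)) (by norm_num)).congr
      fun x hx => ?_
    rw [uIoc_of_le zero_le_one] at hx
    simp only [Real.sqrt_eq_rpow, Real.rpow_neg hx.1.le]
  have h2 : IntervalIntegrable (fun x : ℝ => (√(1 - x))⁻¹) volume 0 1 := by
    simpa using (h1.comp_sub_left 1).symm
  refine (h1.add h2).mono_fun (by unfold arcsineWeight; fun_prop) ?_
  rw [uIoc_of_le zero_le_one, ← restrict_Ioo_eq_restrict_Ioc]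
  refine (ae_restrict_iff' measurableSet_Ioo).2 (ae_of_all _ fun x hx => ?_)
  have ha : 0 < √x := Real.sqrt_pos.2 hx.1
  have hb : 0 < √(1 - x) := Real.sqrt_pos.2 (sub_pos.2 hx.2)
  have ha2 : √x ^ 2 = x := Real.sq_sqrt hx.1.le
  have hb2 : √(1 - x) ^ 2 = 1 - x := Real.sq_sqrt (sub_pos.2 hx.2).le
  simp only [arcsineWeight]
  rw [Real.norm_of_nonneg (by positivity), Real.norm_of_nonneg (by positivity), ← mul_inv,
    inv_add_inv ha.ne' hb.ne', inv_eq_one_div]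
  refine div_le_div_of_nonneg_right ?_ (by positivity)
  nlinarith [mul_pos ha hb]

theorem densityRatio_integrand_mono {s t x : ℝ} (hs : 0 ≤ s) (hst : s ≤ t)
    (hx : x ∈ Icc (0 : ℝ) 1) :
    (s + 2) * ((√(s * x + 2))⁻¹ * (√(s * (1 - x) + 2))⁻¹) ≤
      (t + 2) * ((√(t * x + 2))⁻¹ * (√(t * (1 - x) + 2))⁻¹) := by
  have ht : 0 ≤ t := hs.trans hst
  have hx0 : 0 ≤ x := hx.1
  have hx1 : 0 ≤ 1 - x := sub_nonneg.2 hx.2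
  have hq : ∀ r : ℝ, 0 ≤ r → 0 < (r * x + 2) * (r * (1 - x) + 2) := fun r hr => by positivity
  have hrw : ∀ r : ℝ, 0 ≤ r → (r + 2) * ((√(r * x + 2))⁻¹ * (√(r * (1 - x) + 2))⁻¹) =
      √((r + 2) ^ 2 / ((r * x + 2) * (r * (1 - x) + 2))) := fun r hr => by
    rw [Real.sqrt_div (sq_nonneg _), Real.sqrt_sq (by positivity), Real.sqrt_mul (by positivity),
      ← mul_inv, div_eq_mul_inv]
  rw [hrw s hs, hrw t ht]
  refine Real.sqrt_le_sqrt ?_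
  rw [div_le_div_iff₀ (hq s hs) (hq t ht)]
  have hp0 : 0 ≤ x * (1 - x) := mul_nonneg hx0 hx1
  have hp : 4 * (x * (1 - x)) ≤ 1 := by nlinarith [sq_nonneg (2 * x - 1)]
  have hbr : 0 ≤ 2 * ((t + 2) * (s + 2)) - 4 * (x * (1 - x)) * (t * s + s + t) := by
    have hts : 0 ≤ t * s := mul_nonneg ht hs
    have := mul_le_mul_of_nonneg_right hp (by positivity : 0 ≤ t * s + s + t)
    nlinarith
  have := mul_nonneg (sub_nonneg.2 hst) hbr
  linear_combination this

theorem densityRatio_integrand_le {s x : ℝ} (hs : 0 ≤ s) (hx : x ∈ Icc (0 : ℝ) 1) :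
    (√(s * x + 2))⁻¹ * (√(s * (1 - x) + 2))⁻¹ ≤ 1 := by
  have hx0 : 0 ≤ x := hx.1
  have hx1 : 0 ≤ 1 - x := sub_nonneg.2 hx.2
  have h1 : 0 ≤ s * x := by positivity
  have h2 : 0 ≤ s * (1 - x) := by positivity
  refine mul_le_one₀ (inv_le_one_of_one_le₀ ?_) (by positivity) (inv_le_one_of_one_le₀ ?_) <;>
  · rw [Real.one_le_sqrt]
    linarith

theorem intervalIntegrable_densityRatio {s : ℝ} (hs : 0 ≤ s) :
    IntervalIntegrable (fun x => arcsineWeight x *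
      ((s + 2) * ((√(s * x + 2))⁻¹ * (√(s * (1 - x) + 2))⁻¹))) volume 0 1 := by
  refine (intervalIntegrable_arcsineWeight.mul_const (s + 2)).mono_fun
    (by unfold arcsineWeight; fun_prop) ?_
  rw [uIoc_of_le zero_le_one]
  refine (ae_restrict_iff' measurableSet_Ioc).2 (ae_of_all _ fun x hx => ?_)
  have hw := arcsineWeight_nonneg x
  simp only
  rw [Real.norm_of_nonneg (by positivity), Real.norm_of_nonneg (by positivity)]
  refine mul_le_mul_of_nonneg_left ?_ hw
  exact mul_le_of_le_one_right (by positivity)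
    (densityRatio_integrand_le hs (Ioc_subset_Icc_self hx))

theorem densityRatio_monotoneOn : MonotoneOn densityRatio (Ioi 0) := by
  intro s hs t ht hst
  have hs : 0 < s := hs
  have ht : 0 < t := ht
  refine intervalIntegral.integral_mono_on zero_le_one (intervalIntegrable_densityRatio hs.le)
    (intervalIntegrable_densityRatio ht.le) fun x hx => ?_
  exact mul_le_mul_of_nonneg_left (densityRatio_integrand_mono hs.le hst hx)
    (arcsineWeight_nonneg x)

theorem densityRatio_nonneg {s : ℝ} (hs : 0 < s) : 0 ≤ densityRatio s :=
  intervalIntegral.integral_nonneg zero_le_one fun x _ =>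
    mul_nonneg (arcsineWeight_nonneg x) (by positivity)

theorem densityRatio_mul_inv_le {s : ℝ} (hs : 0 < s) :
    densityRatio s * (s + 2)⁻¹ ≤ ∫ x in (0 : ℝ)..1, arcsineWeight x := by
  rw [← div_eq_mul_inv, div_le_iff₀ (by positivity), ← intervalIntegral.integral_mul_const]
  refine intervalIntegral.integral_mono_on zero_le_one (intervalIntegrable_densityRatio hs.le)
    (intervalIntegrable_arcsineWeight.mul_const _) fun x hx => ?_
  exact mul_le_mul_of_nonneg_left
    (mul_le_of_le_one_right (by positivity) (densityRatio_integrand_le hs.le hx))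
    (arcsineWeight_nonneg x)

theorem besselKernel_convolution {s : ℝ} (hs : 0 < s) :
    ∫ t in (0 : ℝ)..s, besselKernel t * besselKernel (s - t) = (s + 2)⁻¹ * densityRatio s := by
  have h := intervalIntegral.mul_integral_comp_mul_left (a := 0) (b := 1) (c := s)
    (f := fun t => besselKernel t * besselKernel (s - t))
  rw [mul_zero, mul_one] at h
  rw [← h, densityRatio, ← intervalIntegral.integral_const_mul,
    ← intervalIntegral.integral_const_mul]
  refine intervalIntegral.integral_congr fun x _ => ?_
  have hss : √s * √s = s := Real.mul_self_sqrt hs.le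
  have hs0 : √s ≠ 0 := (Real.sqrt_pos.2 hs).ne'
  simp only [besselKernel, arcsineWeight]
  rw [show s - s * x = s * (1 - x) by ring, Real.sqrt_mul hs.le, Real.sqrt_mul hs.le,
    mul_inv, mul_inv]
  field_simp
  rw [Real.sq_sqrt hs.le]

theorem integrableOn_exp_mul_besselKernel {z : ℝ} (hz : 0 < z) :
    IntegrableOn (fun u => Real.exp (-z * u) * besselKernel u) (Ioi 0) := by
  have h := integrableOn_rpow_mul_exp_neg_mul_rpow (p := 1) (s := -(1 / 2)) (b := z)
    (by norm_num) one_pos hz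
  refine Integrable.mono' h (by unfold besselKernel; fun_prop) ?_
  refine (ae_restrict_iff' measurableSet_Ioi).2 (ae_of_all _ fun u hu => ?_)
  have hu : 0 < u := hu
  rw [Real.norm_of_nonneg (by unfold besselKernel; positivity), besselKernel, Real.rpow_one,
    Real.rpow_neg hu.le, ← Real.sqrt_eq_rpow, mul_comm]
  refine mul_le_mul_of_nonneg_right ?_ (by positivity)
  refine mul_le_of_le_one_right (by positivity) (inv_le_one_of_one_le₀ ?_)
  rw [Real.one_le_sqrt]
  linarith

theorem K0_eq_laplace (z : ℝ) :
    ∫ u in Ioi (0 : ℝ), Real.exp (-z * u) * besselKernel u = Real.exp z * K0 z := by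
  have himg : (fun t : ℝ => Real.cosh t - 1) '' Ioi 0 = Ioi 0 := by
    ext u
    constructor
    · rintro ⟨t, ht, rfl⟩
      exact sub_pos.2 (Real.one_lt_cosh.2 (ne_of_gt ht))
    · intro hu
      have hu : 0 < u := hu
      refine ⟨Real.arcosh (u + 1), Real.arcosh_pos (by linarith), ?_⟩
      simp only [Real.cosh_arcosh (by linarith : 1 ≤ u + 1), add_sub_cancel_right]
  have hinj : InjOn (fun t : ℝ => Real.cosh t - 1) (Ioi 0) := fun x hx y hy hxy =>
    Real.cosh_strictMonoOn.injOn (Ioi_subset_Ici_self hx) (Ioi_subset_Ici_self hy)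
      (sub_left_injective hxy)
  have h := integral_image_eq_integral_abs_deriv_smul measurableSet_Ioi
    (fun t _ => ((Real.hasDerivAt_cosh t).sub_const 1).hasDerivWithinAt) hinj
    (fun u => Real.exp (-z * u) * besselKernel u)
  rw [himg] at h
  rw [h, K0, ← integral_const_mul]
  refine setIntegral_congr_fun measurableSet_Ioi fun t ht => ?_
  have hsinh : 0 < Real.sinh t := Real.sinh_pos_iff.2 ht
  have hk : besselKernel (Real.cosh t - 1) = (Real.sinh t)⁻¹ := by
    rw [besselKernel, ← mul_inv, ← Real.sqrt_mul (sub_nonneg.2 (Real.one_le_cosh t)),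
      show (Real.cosh t - 1) * (Real.cosh t - 1 + 2) = Real.sinh t ^ 2 by
        rw [Real.sinh_sq]; ring, Real.sqrt_sq hsinh.le]
  simp only [smul_eq_mul]
  rw [hk, abs_of_pos hsinh, ← Real.exp_add, mul_comm, mul_assoc, inv_mul_cancel₀ hsinh.ne', mul_one]
  congr 1
  ring

theorem K0_sq_eq_laplace {z : ℝ} (hz : 0 < z) :
    ∫ s in Ioi (0 : ℝ), Real.exp (-z * s) * ((s + 2)⁻¹ * densityRatio s) =
      Real.exp (2 * z) * K0 z ^ 2 := by
  have hint := integrableOn_exp_mul_besselKernel hz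
  have h := integral_posConvolution (ν := volume) (μ := volume) hint hint
    (ContinuousLinearMap.mul ℝ ℝ)
  simp only [ContinuousLinearMap.mul_apply', K0_eq_laplace] at h
  rw [show Real.exp (2 * z) * K0 z ^ 2 = Real.exp z * K0 z * (Real.exp z * K0 z) by
    rw [two_mul, Real.exp_add]; ring, ← h]
  refine setIntegral_congr_fun measurableSet_Ioi fun s hs => ?_
  rw [← besselKernel_convolution hs, ← intervalIntegral.integral_const_mul]
  refine intervalIntegral.integral_congr fun t _ => ?_
  rw [show -z * s = -z * t + -z * (s - t) by ring, Real.exp_add]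
  ring

theorem E1_eq_laplace {z : ℝ} (hz : 0 < z) :
    ∫ s in Ioi (0 : ℝ), Real.exp (-z * s) * (s + 2)⁻¹ = Real.exp (2 * z) * E1 (2 * z) := by
  have himg : (fun s : ℝ => z * (s + 2)) '' Ioi 0 = Ioi (2 * z) := by
    ext u
    constructor
    · rintro ⟨s, hs, rfl⟩
      have hs : 0 < s := hs
      have := mul_pos hz hs
      simp only [mem_Ioi]
      linarith
    · intro hu
      have hu : 2 * z < u := hu
      refine ⟨u / z - 2, ?_, ?_⟩
      · rw [mem_Ioi, sub_pos, lt_div_iff₀ hz]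
        exact hu
      · field_simp
        ring
  have hinj : InjOn (fun s : ℝ => z * (s + 2)) (Ioi 0) := fun x _ y _ hxy =>
    add_left_injective 2 (mul_left_cancel₀ hz.ne' hxy)
  have h := integral_image_eq_integral_abs_deriv_smul measurableSet_Ioi
    (fun s _ => (((hasDerivAt_id s).add_const 2).const_mul z).hasDerivWithinAt) hinj
    (fun t => Real.exp (-t) / t)
  simp only [id] at h
  rw [himg] at h
  rw [E1, h, ← integral_const_mul]
  refine setIntegral_congr_fun measurableSet_Ioi fun s hs => ?_
  have hs : 0 < s := hs
  simp only [smul_eq_mul, mul_one, abs_of_pos hz]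
  rw [show -(z * (s + 2)) = -z * s - 2 * z by ring, Real.exp_sub]
  field_simp

/-- Corollary: `z ↦ (K₀(z))² / E₁(2z)` is completely monotone on `(0,∞)`. -/
theorem K0_sq_div_E1_CM :
    ∀ n : ℕ, ∀ z : ℝ, 0 < z →
      0 ≤ (-1 : ℝ) ^ n * iteratedDeriv n (fun w => (K0 w) ^ 2 / E1 (2 * w)) z := by
  intro n z hz
  have heq : (fun w => (K0 w) ^ 2 / E1 (2 * w)) =ᶠ[𝓝 z] fun w =>
      (∫ s in Ioi (0 : ℝ), Real.exp (-w * s) * ((s + 2)⁻¹ * densityRatio s)) /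
        ∫ s in Ioi (0 : ℝ), Real.exp (-w * s) * (s + 2)⁻¹ := by
    filter_upwards [Ioi_mem_nhds hz] with w hw
    rw [K0_sq_eq_laplace hw, E1_eq_laplace hw, mul_div_mul_left _ _ (Real.exp_pos _).ne']
  rw [(heq.iteratedDeriv n).eq_of_nhds]
  exact laplace_quotient_completelyMonotone densityRatio_monotoneOn
    (fun _ => densityRatio_nonneg) (fun _ => densityRatio_mul_inv_le) n hz
end

section
/- Let a > 0 and b > 0. Then the sum of two independent beta prime(a,b) random variables stochastically dominates a beta prime(2a,b) random variable, i.e. ∫₀^∞ ∫₀^∞ 1_{x+y > t} f_{a,b}(x) f_{a,b}(y) dx dy ≥ ∫_t^∞ f_{2a,b}(x) dx for every t > 0, if and only if b ≤ 1. -/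
open MeasureTheory Set

/-- The beta prime density with parameters `a, b`. -/
noncomputable def betaPrimeDensity (a b x : ℝ) : ℝ :=
  Real.Gamma (a + b) / (Real.Gamma a * Real.Gamma b) * x ^ (a - 1) * (1 + x) ^ (-(a + b))

open ProbabilityTheory in
theorem integrable_betaPDFReal {a b : ℝ} (ha : 0 < a) (hb : 0 < b) :
    Integrable (betaPDFReal a b) ∧ ∫ x, betaPDFReal a b x = 1 := by
  have hnn : 0 ≤ᵐ[volume] betaPDFReal a b := by
    refine Filter.Eventually.of_forall fun x => ?_
    by_cases h : 0 < x ∧ x < 1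
    · exact (betaPDFReal_pos h.1 h.2 ha hb).le
    · simp [betaPDFReal, h]
  have h1 : ∫⁻ x, ENNReal.ofReal (betaPDFReal a b x) = 1 := lintegral_betaPDF_eq_one ha hb
  have hm := (measurable_betaPDFReal a b).aestronglyMeasurable (μ := volume)
  refine ⟨(lintegral_ofReal_ne_top_iff_integrable hm hnn).1 (by simp [h1]), ?_⟩
  rw [integral_eq_lintegral_of_nonneg_ae hnn hm, h1, ENNReal.toReal_one]

theorem image_div_one_add_Ioi : image (fun x : ℝ => x / (1 + x)) (Ioi 0) = Ioo 0 1 := by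
  ext y
  constructor
  · rintro ⟨x, hx, rfl⟩
    have hx : 0 < x := hx
    exact ⟨by positivity, (div_lt_one (by positivity)).2 (by linarith)⟩
  · rintro ⟨h0, h1⟩
    have h : 0 < 1 - y := by linarith
    refine ⟨y / (1 - y), div_pos h0 h, ?_⟩
    simp only
    field_simp
    ring

theorem hasDerivAt_div_one_add {x : ℝ} (hx : 0 < x) :
    HasDerivAt (fun x : ℝ => x / (1 + x)) (1 / (1 + x) ^ 2) x := by
  have := (hasDerivAt_id x).div ((hasDerivAt_id x).const_add 1) (by simp; positivity)
  convert! this using 1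
  simp

theorem monotoneOn_div_one_add : MonotoneOn (fun x : ℝ => x / (1 + x)) (Ioi 0) := by
  intro x hx y hy hxy
  have hx : 0 < x := hx
  have hy : 0 < y := hy
  simp only
  rw [div_le_div_iff₀ (by positivity) (by positivity)]
  linarith

open ProbabilityTheory in
theorem deriv_mul_betaPDFReal_comp {a b x : ℝ} (hx : 0 < x) :
    (1 / (1 + x) ^ 2) • betaPDFReal a b (x / (1 + x)) = betaPrimeDensity a b x := by
  have h1 : (0 : ℝ) < 1 + x := by positivity
  have h2 : 0 < x / (1 + x) ∧ x / (1 + x) < 1 :=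
    ⟨by positivity, (div_lt_one h1).2 (by linarith)⟩
  have h3 : 1 - x / (1 + x) = (1 + x)⁻¹ := by field_simp; ring
  rw [betaPDFReal, if_pos h2, h3, betaPrimeDensity, beta, one_div_div, smul_eq_mul,
    Real.div_rpow hx.le h1.le, Real.inv_rpow h1.le, div_eq_mul_inv (x ^ (a - 1)),
    ← Real.rpow_neg h1.le, ← Real.rpow_neg h1.le, one_div, ← Real.rpow_natCast,
    ← Real.rpow_neg h1.le]
  have h4 : (1 + x) ^ (-(a + b)) =
      (1 + x) ^ (-((2 : ℕ) : ℝ)) * (1 + x) ^ (-(a - 1)) * (1 + x) ^ (-(b - 1)) := by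
    rw [← Real.rpow_add h1, ← Real.rpow_add h1]
    congr 1
    push_cast
    ring
  rw [h4]
  ring

theorem integrableOn_betaPrimeDensity {a b : ℝ} (ha : 0 < a) (hb : 0 < b) :
    IntegrableOn (betaPrimeDensity a b) (Ioi 0) := by
  have h := integrableOn_image_iff_integrableOn_deriv_smul_of_monotoneOn measurableSet_Ioi
    (fun x hx => (hasDerivAt_div_one_add hx).hasDerivWithinAt) monotoneOn_div_one_add
    (ProbabilityTheory.betaPDFReal a b)
  rw [image_div_one_add_Ioi] at h
  exact (h.1 (integrable_betaPDFReal ha hb).1.integrableOn).congr_fun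
    (fun x hx => deriv_mul_betaPDFReal_comp hx) measurableSet_Ioi

theorem integral_betaPrimeDensity {a b : ℝ} (ha : 0 < a) (hb : 0 < b) :
    ∫ x in Ioi 0, betaPrimeDensity a b x = 1 := by
  have h := integral_image_eq_integral_deriv_smul_of_monotoneOn measurableSet_Ioi
    (fun x hx => (hasDerivAt_div_one_add hx).hasDerivWithinAt) monotoneOn_div_one_add
    (ProbabilityTheory.betaPDFReal a b)
  have hz : ∀ x, x ∉ Ioo (0 : ℝ) 1 → ProbabilityTheory.betaPDFReal a b x = 0 :=
    fun x hx => if_neg hx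
  rw [image_div_one_add_Ioi, setIntegral_eq_integral_of_forall_compl_eq_zero hz,
    (integrable_betaPDFReal ha hb).2] at h
  rw [h]
  exact setIntegral_congr_fun measurableSet_Ioi
    fun x hx => (deriv_mul_betaPDFReal_comp hx).symm

theorem betaPrimeDensity_pos {a b x : ℝ} (ha : 0 < a) (hb : 0 < b) (hx : 0 < x) :
    0 < betaPrimeDensity a b x := by
  have := Real.Gamma_pos_of_pos ha
  have := Real.Gamma_pos_of_pos hb
  have := Real.Gamma_pos_of_pos (add_pos ha hb)
  unfold betaPrimeDensity
  positivity

theorem continuousAt_betaPrimeDensity {a b x : ℝ} (hx : 0 < x) :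
    ContinuousAt (betaPrimeDensity a b) x := by
  have h1 : (1 : ℝ) + x ≠ 0 := by positivity
  unfold betaPrimeDensity
  exact (continuousAt_const.mul (continuousAt_id.rpow_const (Or.inl hx.ne'))).mul
    ((continuousAt_const.add continuousAt_id).rpow_const (Or.inl h1))

theorem measurable_betaPrimeDensity (a b : ℝ) : Measurable (betaPrimeDensity a b) := by
  unfold betaPrimeDensity
  fun_prop

/-! ### Strict monotonicity of the Gamma quotient -/

theorem Gamma_add_div_Gamma_lt {p q c : ℝ} (hp : 0 < p) (hq : 0 < q) (hc : 0 < c) :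
    Real.Gamma (p + c) / Real.Gamma p < Real.Gamma (p + q + c) / Real.Gamma (p + q) := by
  have gp := Real.Gamma_pos_of_pos hp
  have gc := Real.Gamma_pos_of_pos hc
  have gpc := Real.Gamma_pos_of_pos (add_pos hp hc)
  have gpq := Real.Gamma_pos_of_pos (add_pos hp hq)
  have gpqc := Real.Gamma_pos_of_pos (add_pos (add_pos hp hq) hc)
  set K := Real.Gamma (p + c) / Real.Gamma p with hK
  set L := Real.Gamma (p + q + c) / Real.Gamma (p + q) with hL
  have hKpos : 0 < K := by positivity
  have hLpos : 0 < L := by positivity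
  have key : ∀ x ∈ Ioi (0 : ℝ),
      0 < betaPrimeDensity p c x - K / L * betaPrimeDensity (p + q) c x := by
    intro x hx
    have hx : 0 < x := hx
    have h1 : 0 < 1 + x := by positivity
    have h : betaPrimeDensity (p + q) c x
        = L / K * betaPrimeDensity p c x * (x / (1 + x)) ^ q := by
      rw [Real.div_rpow hx.le h1.le, div_eq_mul_inv (x ^ q), ← Real.rpow_neg h1.le]
      unfold betaPrimeDensity
      rw [show p + q - 1 = (p - 1) + q by ring, Real.rpow_add hx,
        show -(p + q + c) = -(p + c) + -q by ring, Real.rpow_add h1, hK, hL]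
      field_simp
    have hlt : (x / (1 + x)) ^ q < 1 :=
      Real.rpow_lt_one (by positivity) ((div_lt_one h1).2 (by linarith)) hq
    rw [h]
    have hf := betaPrimeDensity_pos hp hc hx
    field_simp
    nlinarith
  have i1 := integrableOn_betaPrimeDensity hp hc
  have i2 := (integrableOn_betaPrimeDensity (add_pos hp hq) hc).const_mul (K / L)
  have hpos : 0 < ∫ x in Ioi (0 : ℝ),
      (betaPrimeDensity p c x - K / L * betaPrimeDensity (p + q) c x) := by
    rw [setIntegral_pos_iff_support_of_nonneg_ae
      (ae_restrict_of_forall_mem measurableSet_Ioi fun x hx => (key x hx).le) (i1.sub i2)]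
    rw [inter_eq_right.2 fun x hx => Function.mem_support.2 (key x hx).ne']
    simp
  rw [integral_sub i1 i2, integral_const_mul, integral_betaPrimeDensity hp hc,
    integral_betaPrimeDensity (add_pos hp hq) hc, mul_one, sub_pos, div_lt_one hLpos] at hpos
  exact hpos

theorem two_mul_betaPrime_const_lt {a b : ℝ} (ha : 0 < a) (hb : 1 < b) :
    2 * (Real.Gamma (a + b) / (Real.Gamma a * Real.Gamma b))
      < Real.Gamma (2 * a + b) / (Real.Gamma (2 * a) * Real.Gamma b) := by
  have h := Gamma_add_div_Gamma_lt (p := a + 1) (q := a) (c := b - 1)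
    (by positivity) ha (by linarith)
  rw [show a + 1 + a = 2 * a + 1 by ring, show a + 1 + (b - 1) = a + b by ring,
    show 2 * a + 1 + (b - 1) = 2 * a + b by ring, Real.Gamma_add_one ha.ne',
    Real.Gamma_add_one (by positivity)] at h
  have ga := Real.Gamma_pos_of_pos ha
  have ga2 := Real.Gamma_pos_of_pos (show 0 < 2 * a by positivity)
  have gb := Real.Gamma_pos_of_pos (show 0 < b by linarith)
  calc _ = Real.Gamma (a + b) / (a * Real.Gamma a) * (2 * a / Real.Gamma b) := by
        field_simp
    _ < Real.Gamma (2 * a + b) / (2 * a * Real.Gamma (2 * a)) * (2 * a / Real.Gamma b) := by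
        gcongr
    _ = _ := by field_simp

/-! ### Bounds for the tail of a sum -/

section Convolution

variable {f : ℝ → ℝ} {r s t : ℝ}

theorem integrable_mul_prod_indicator (hf : IntegrableOn f (Ioi 0)) (t : ℝ) :
    Integrable (fun z : ℝ × ℝ => if t < z.1 + z.2 then f z.1 * f z.2 else 0)
      ((volume.restrict (Ioi 0)).prod (volume.restrict (Ioi 0))) :=
  (hf.mul_prod hf).indicator (s := {z : ℝ × ℝ | t < z.1 + z.2})
    (measurableSet_lt measurable_const (measurable_fst.add measurable_snd))

theorem setIntegral_Ioi_indicator (f : ℝ → ℝ) (hs : 0 ≤ s) :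
    ∫ x in Ioi 0, (Ioi s).indicator f x = ∫ x in Ioi s, f x := by
  rw [setIntegral_indicator measurableSet_Ioi, inter_eq_right.2 (Ioi_subset_Ioi hs)]

theorem sq_sub_sq_le_tail_add (hf : IntegrableOn f (Ioi 0)) (h0 : ∀ x ∈ Ioi (0 : ℝ), 0 ≤ f x) :
    (∫ x in Ioi 0, f x) ^ 2 - (∫ x in Ioc 0 t, f x) ^ 2 ≤
      ∫ x in Ioi (0 : ℝ), ∫ y in Ioi (0 : ℝ), (if t < x + y then f x * f y else 0) := by
  have hg : IntegrableOn ((Iic t).indicator f) (Ioi 0) := hf.indicator measurableSet_Iic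
  have hgi : ∫ x in Ioi 0, (Iic t).indicator f x = ∫ x in Ioc 0 t, f x := by
    rw [setIntegral_indicator measurableSet_Iic, Ioi_inter_Iic]
  rw [← integral_prod _ (integrable_mul_prod_indicator hf t), sq, sq, ← hgi,
    ← integral_prod_mul, ← integral_prod_mul, ← integral_sub (hf.mul_prod hf) (hg.mul_prod hg)]
  have hi := (hf.mul_prod hf).sub (hg.mul_prod hg)
  have hj := integrable_mul_prod_indicator hf t
  refine integral_mono_ae hi hj ?_
  rw [Measure.prod_restrict]
  refine ae_restrict_of_forall_mem (measurableSet_Ioi.prod measurableSet_Ioi) ?_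
  rintro ⟨x, y⟩ ⟨hx, hy⟩
  have hfx := h0 x hx
  have hfy := h0 y hy
  have hx : 0 < x := hx
  have hy : 0 < y := hy
  have hxy := mul_nonneg hfx hfy
  simp only [indicator, mem_Iic]
  split_ifs <;> linarith

theorem tail_add_le (hf : IntegrableOn f (Ioi 0)) (h0 : ∀ x ∈ Ioi (0 : ℝ), 0 ≤ f x)
    (hr : 0 ≤ r) (hs : 0 ≤ s) (hrs : r + s ≤ t) :
    ∫ x in Ioi (0 : ℝ), ∫ y in Ioi (0 : ℝ), (if t < x + y then f x * f y else 0) ≤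
      2 * (∫ x in Ioi 0, f x) * (∫ x in Ioi s, f x) + (∫ x in Ioi r, f x) ^ 2 := by
  have hgs : IntegrableOn ((Ioi s).indicator f) (Ioi 0) := hf.indicator measurableSet_Ioi
  have hgr : IntegrableOn ((Ioi r).indicator f) (Ioi 0) := hf.indicator measurableSet_Ioi
  have hgg := (hf.mul_prod hgs).fun_add (hgs.mul_prod hf)
  have hi := hgg.fun_add (hgr.mul_prod hgr)
  have hj := integrable_mul_prod_indicator hf t
  have heq : 2 * (∫ x in Ioi 0, f x) * (∫ x in Ioi s, f x) + (∫ x in Ioi r, f x) ^ 2 =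
      ∫ z, (f z.1 * (Ioi s).indicator f z.2 + (Ioi s).indicator f z.1 * f z.2
        + (Ioi r).indicator f z.1 * (Ioi r).indicator f z.2)
        ∂((volume.restrict (Ioi 0)).prod (volume.restrict (Ioi 0))) := by
    rw [integral_add hgg (hgr.mul_prod hgr),
      integral_add (hf.mul_prod hgs) (hgs.mul_prod hf), integral_prod_mul, integral_prod_mul,
      integral_prod_mul, setIntegral_Ioi_indicator f hs, setIntegral_Ioi_indicator f hr]
    ring
  rw [← integral_prod _ hj, heq]
  refine integral_mono_ae hj hi ?_
  rw [Measure.prod_restrict]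
  refine ae_restrict_of_forall_mem (measurableSet_Ioi.prod measurableSet_Ioi) ?_
  rintro ⟨x, y⟩ ⟨hx, hy⟩
  have hfx := h0 x hx
  have hfy := h0 y hy
  have hxy := mul_nonneg hfx hfy
  simp only [indicator, mem_Ioi]
  split_ifs <;> linarith

end Convolution

/-! ### Comparison of distribution functions -/

theorem intervalIntegrable_betaPrimeDensity {a b t : ℝ} (ha : 0 < a) (hb : 0 < b) (ht : 0 ≤ t) :
    IntervalIntegrable (betaPrimeDensity a b) volume 0 t :=
  (intervalIntegrable_iff_integrableOn_Ioc_of_le ht).2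
    ((integrableOn_betaPrimeDensity ha hb).mono_set Ioc_subset_Ioi_self)

theorem hasDerivAt_integral_betaPrimeDensity {a b t : ℝ} (ha : 0 < a) (hb : 0 < b) (ht : 0 < t) :
    HasDerivAt (fun u => ∫ x in (0 : ℝ)..u, betaPrimeDensity a b x) (betaPrimeDensity a b t) t :=
  intervalIntegral.integral_hasDerivAt_right (intervalIntegrable_betaPrimeDensity ha hb ht.le)
    (measurable_betaPrimeDensity a b).stronglyMeasurable.stronglyMeasurableAtFilter
    (continuousAt_betaPrimeDensity ht)

theorem continuousOn_integral_betaPrimeDensity {a b : ℝ} (t : ℝ) (ha : 0 < a) (hb : 0 < b) :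
    ContinuousOn (fun u => ∫ x in (0 : ℝ)..u, betaPrimeDensity a b x) (Icc 0 t) := by
  rcases le_or_gt 0 t with ht | ht
  · rw [← uIcc_of_le ht]
    refine intervalIntegral.continuousOn_primitive_interval ?_
    rw [uIcc_of_le ht, integrableOn_Icc_iff_integrableOn_Ioc]
    exact (integrableOn_betaPrimeDensity ha hb).mono_set Ioc_subset_Ioi_self
  · simp [Icc_eq_empty_of_lt ht]

theorem tendsto_integral_betaPrimeDensity {a b : ℝ} (ha : 0 < a) (hb : 0 < b) :
    Filter.Tendsto (fun u => ∫ x in (0 : ℝ)..u, betaPrimeDensity a b x) Filter.atTop (nhds 1) := by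
  rw [← integral_betaPrimeDensity ha hb]
  exact intervalIntegral_tendsto_integral_Ioi 0 (integrableOn_betaPrimeDensity ha hb)
    Filter.tendsto_id

theorem hasDerivAt_rpow_mul_one_add_rpow_neg {a t : ℝ} (ht : 0 < t) :
    HasDerivAt (fun u : ℝ => u ^ a * (1 + u) ^ (-a))
      (a * t ^ (a - 1) * (1 + t) ^ (-(a + 1))) t := by
  have h1 : 0 < 1 + t := by positivity
  have h := (Real.hasDerivAt_rpow_const (p := a) (Or.inl ht.ne')).mul
    (((hasDerivAt_id t).const_add 1).rpow_const (p := -a) (Or.inl h1.ne'))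
  convert! h using 1
  have e1 : t ^ a = t ^ (a - 1) * t := by
    rw [← Real.rpow_add_one ht.ne', sub_add_cancel]
  have e2 : (1 + t) ^ (-a) = (1 + t) ^ (-(a + 1)) * (1 + t) := by
    rw [← Real.rpow_add_one h1.ne']; ring_nf
  simp only [id]
  rw [e1, e2, show -a - 1 = -(a + 1) by ring]
  ring

theorem integral_betaPrimeDensity_le {a b t : ℝ} (ha : 0 < a) (hb : 0 < b) (hb1 : b ≤ 1)
    (ht : 0 ≤ t) :
    ∫ x in (0 : ℝ)..t, betaPrimeDensity a b x ≤
      Real.Gamma (a + b) / (Real.Gamma a * Real.Gamma b) / a *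
        (t ^ a * (1 + t) ^ (-a) * (1 + t) ^ (1 - b)) := by
  set k := Real.Gamma (a + b) / (Real.Gamma a * Real.Gamma b) with hk
  have hkpos : 0 < k := div_pos (Real.Gamma_pos_of_pos (add_pos ha hb))
    (mul_pos (Real.Gamma_pos_of_pos ha) (Real.Gamma_pos_of_pos hb))
  let H : ℝ → ℝ := fun u => k / a * (u ^ a * (1 + u) ^ (-a) * (1 + u) ^ (1 - b))
      - ∫ x in (0 : ℝ)..u, betaPrimeDensity a b x
  have hH : MonotoneOn H (Icc 0 t) := by
    refine monotoneOn_of_hasDerivWithinAt_nonneg (convex_Icc 0 t)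
      (f' := fun u => k / a * (u ^ a * (1 + u) ^ (-a) * ((1 - b) * (1 + u) ^ (-b)))) ?_ ?_ ?_
    · refine ContinuousOn.sub (fun u hu => ContinuousAt.continuousWithinAt ?_)
        (continuousOn_integral_betaPrimeDensity t ha hb)
      have h1 : 1 + u ≠ 0 := by linarith [hu.1]
      exact continuousAt_const.mul (((continuousAt_id.rpow_const (Or.inr ha.le)).mul
        ((continuousAt_const.add continuousAt_id).rpow_const (Or.inl h1))).mul
        ((continuousAt_const.add continuousAt_id).rpow_const (Or.inl h1)))
    · intro u hu
      rw [interior_Icc] at hu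
      have hu0 := hu.1
      have h1 : 0 < 1 + u := by linarith
      have h := (((hasDerivAt_rpow_mul_one_add_rpow_neg (a := a) hu0).mul
        (((hasDerivAt_id u).const_add 1).rpow_const (p := 1 - b) (Or.inl h1.ne'))).const_mul
          (k / a)).sub (hasDerivAt_integral_betaPrimeDensity ha hb hu0)
      refine HasDerivAt.hasDerivWithinAt ?_
      convert! h using 1
      have e : (1 + u) ^ (-(a + b)) = (1 + u) ^ (-(a + 1)) * (1 + u) ^ (1 - b) := by
        rw [← Real.rpow_add h1]; ring_nf
      simp only [id, betaPrimeDensity, ← hk]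
      rw [e, show 1 - b - 1 = -b by ring]
      field_simp
      ring
    · intro u hu
      rw [interior_Icc] at hu
      have hu0 := hu.1
      have : 0 ≤ 1 - b := by linarith
      positivity
  have h := hH (left_mem_Icc.2 ht) (right_mem_Icc.2 ht) ht
  simp only [H, Real.zero_rpow ha.ne', intervalIntegral.integral_same] at h
  linarith

theorem monotoneOn_integral_betaPrimeDensity_div {a b : ℝ} (ha : 0 < a) (hb : 0 < b)
    (hb1 : b ≤ 1) :
    MonotoneOn (fun t => (∫ x in (0 : ℝ)..t, betaPrimeDensity a b x) / (t ^ a * (1 + t) ^ (-a)))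
      (Ioi 0) := by
  have hd : ∀ t ∈ Ioi (0 : ℝ), HasDerivAt (fun t => (∫ x in (0 : ℝ)..t, betaPrimeDensity a b x)
      / (t ^ a * (1 + t) ^ (-a))) _ t := fun t ht =>
    (hasDerivAt_integral_betaPrimeDensity ha hb ht).fun_div
      (hasDerivAt_rpow_mul_one_add_rpow_neg (a := a) ht) (by
        have : 0 < t := ht
        positivity)
  refine monotoneOn_of_hasDerivWithinAt_nonneg (convex_Ioi 0)
    (fun t ht => (hd t ht).continuousAt.continuousWithinAt)
    (fun t ht => (hd t (interior_subset ht)).hasDerivWithinAt) ?_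
  intro t ht
  have ht : 0 < t := by simpa using ht
  have h1 : 0 < 1 + t := by positivity
  refine div_nonneg ?_ (sq_nonneg _)
  have h := integral_betaPrimeDensity_le ha hb hb1 ht.le
  have e : (1 + t) ^ (-(a + b)) = (1 + t) ^ (-(a + 1)) * (1 + t) ^ (1 - b) := by
    rw [← Real.rpow_add h1]; ring_nf
  have h2 := mul_le_mul_of_nonneg_right h
    (show 0 ≤ a * t ^ (a - 1) * (1 + t) ^ (-(a + 1)) by positivity)
  rw [sub_nonneg]
  refine h2.trans (le_of_eq ?_)
  simp only [betaPrimeDensity]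
  rw [e]
  field_simp

theorem sq_integral_betaPrimeDensity_le {a b t : ℝ} (ha : 0 < a) (hb : 0 < b) (hb1 : b ≤ 1)
    (ht : 0 < t) :
    (∫ x in (0 : ℝ)..t, betaPrimeDensity a b x) ^ 2
      ≤ ∫ x in (0 : ℝ)..t, betaPrimeDensity (2 * a) b x := by
  have h2a : 0 < 2 * a := by positivity
  set F : ℝ → ℝ := fun u => ∫ x in (0 : ℝ)..u, betaPrimeDensity a b x with hF
  set F₂ : ℝ → ℝ := fun u => ∫ x in (0 : ℝ)..u, betaPrimeDensity (2 * a) b x with hF₂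
  let w : ℝ → ℝ := fun u => u ^ a * (1 + u) ^ (-a)
  obtain ⟨κ, hκ⟩ : ∃ κ : ℝ, ∀ u : ℝ, 0 < u →
      betaPrimeDensity (2 * a) b u = κ * w u * betaPrimeDensity a b u := by
    have ga := Real.Gamma_pos_of_pos ha
    have gb := Real.Gamma_pos_of_pos hb
    have gab := Real.Gamma_pos_of_pos (add_pos ha hb)
    refine ⟨Real.Gamma (2 * a + b) / (Real.Gamma (2 * a) * Real.Gamma b) /
      (Real.Gamma (a + b) / (Real.Gamma a * Real.Gamma b)), fun u hu => ?_⟩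
    have h1 : 0 < 1 + u := by positivity
    simp only [betaPrimeDensity, w]
    rw [show 2 * a - 1 = a + (a - 1) by ring, Real.rpow_add hu,
      show -(2 * a + b) = -a + -(a + b) by ring, Real.rpow_add h1]
    field_simp
  have hw : ∀ u, 0 < u → 0 < w u := fun u hu => by positivity
  have hd : ∀ u, 0 < u → HasDerivAt (fun u => F₂ u - F u ^ 2)
      (betaPrimeDensity a b u * (κ * w u - 2 * F u)) u := fun u hu => by
    have h := (hasDerivAt_integral_betaPrimeDensity h2a hb hu).fun_sub
      ((hasDerivAt_integral_betaPrimeDensity ha hb hu).fun_pow 2)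
    convert! h using 1
    rw [hκ u hu]
    simp only [hF]
    ring
  have hmono := monotoneOn_integral_betaPrimeDensity_div ha hb hb1
  change F t ^ 2 ≤ F₂ t
  rcases le_total (2 * F t) (κ * w t) with h | h
  · have hD : MonotoneOn (fun u => F₂ u - F u ^ 2) (Icc 0 t) := by
      refine monotoneOn_of_hasDerivWithinAt_nonneg (convex_Icc 0 t)
        ((continuousOn_integral_betaPrimeDensity t h2a hb).sub
          ((continuousOn_integral_betaPrimeDensity t ha hb).pow 2))
        (f' := fun u => betaPrimeDensity a b u * (κ * w u - 2 * F u)) ?_ ?_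
      · intro u hu
        rw [interior_Icc] at hu
        exact (hd u hu.1).hasDerivWithinAt
      · intro u hu
        rw [interior_Icc] at hu
        refine mul_nonneg (betaPrimeDensity_pos ha hb hu.1).le ?_
        have h3 : F u / w u ≤ F t / w t := hmono hu.1 ht hu.2.le
        have h4 : F t / w t ≤ κ / 2 := by
          rw [div_le_iff₀ (hw t ht)]; linarith
        have h5 := (div_le_iff₀ (hw u hu.1)).1 (h3.trans h4)
        linarith
    have h6 := hD (left_mem_Icc.2 ht.le) (right_mem_Icc.2 ht.le) ht.le
    simp only [hF, hF₂, intervalIntegral.integral_same] at h6 ⊢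
    linarith
  · have hD : AntitoneOn (fun u => F₂ u - F u ^ 2) (Ici t) := by
      refine antitoneOn_of_hasDerivWithinAt_nonpos (convex_Ici t)
        (fun u hu => (hd u (ht.trans_le hu)).continuousAt.continuousWithinAt)
        (f' := fun u => betaPrimeDensity a b u * (κ * w u - 2 * F u)) ?_ ?_
      · intro u hu
        rw [interior_Ici] at hu
        exact (hd u (ht.trans hu)).hasDerivWithinAt
      · intro u hu
        rw [interior_Ici] at hu
        have hu0 : 0 < u := ht.trans hu
        refine mul_nonpos_of_nonneg_of_nonpos (betaPrimeDensity_pos ha hb hu0).le ?_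
        have h3 : F t / w t ≤ F u / w u := hmono ht hu0 (le_of_lt hu)
        have h4 : κ / 2 ≤ F t / w t := by
          rw [le_div_iff₀ (hw t ht)]; linarith
        have h5 := (le_div_iff₀ (hw u hu0)).1 (h4.trans h3)
        linarith
    have hlim : Filter.Tendsto (fun u => F₂ u - F u ^ 2) Filter.atTop (nhds (1 - 1 ^ 2)) :=
      (tendsto_integral_betaPrimeDensity h2a hb).sub
        ((tendsto_integral_betaPrimeDensity ha hb).pow 2)
    have h6 := le_of_tendsto hlim ((Filter.eventually_ge_atTop t).mono
      fun u hu => hD self_mem_Ici hu hu)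
    simp only at h6
    linarith

/-! ### Tail bounds -/

theorem betaPrimeDensity_eq {a b x : ℝ} (hx : 0 < x) :
    betaPrimeDensity a b x = Real.Gamma (a + b) / (Real.Gamma a * Real.Gamma b) *
      (1 + 1 / x) ^ (-(a + b)) * x ^ (-b - 1) := by
  have h : 1 + x = (1 + 1 / x) * x := by field_simp; ring
  rw [betaPrimeDensity, h, Real.mul_rpow (by positivity) hx.le,
    show -b - 1 = (a - 1) + -(a + b) by ring, Real.rpow_add hx]
  ring

theorem integral_const_mul_rpow_Ioi {b s : ℝ} (c : ℝ) (hb : 0 < b) (hs : 0 < s) :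
    ∫ x in Ioi s, c * x ^ (-b - 1) = c / b * s ^ (-b) := by
  rw [integral_const_mul, integral_Ioi_rpow_of_lt (by linarith) hs, sub_add_cancel, neg_div_neg_eq]
  ring

theorem integral_Ioi_betaPrimeDensity_le {a b s : ℝ} (ha : 0 < a) (hb : 0 < b) (hs : 0 < s) :
    ∫ x in Ioi s, betaPrimeDensity a b x ≤
      Real.Gamma (a + b) / (Real.Gamma a * Real.Gamma b) / b * s ^ (-b) := by
  rw [← integral_const_mul_rpow_Ioi _ hb hs]
  refine setIntegral_mono_on ((integrableOn_betaPrimeDensity ha hb).mono_set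
    (Ioi_subset_Ioi hs.le)) ((integrableOn_Ioi_rpow_of_lt (by linarith) hs).const_mul _)
    measurableSet_Ioi fun x hx => ?_
  have hx0 : 0 < x := hs.trans hx
  have ga := Real.Gamma_pos_of_pos ha
  have gb := Real.Gamma_pos_of_pos hb
  have gab := Real.Gamma_pos_of_pos (add_pos ha hb)
  rw [betaPrimeDensity_eq hx0]
  have h : (1 + 1 / x) ^ (-(a + b)) ≤ 1 :=
    Real.rpow_le_one_of_one_le_of_nonpos (by simp [hx0.le]) (by linarith)
  gcongr
  exact mul_le_of_le_one_right (by positivity) h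

theorem le_integral_Ioi_betaPrimeDensity {a b s : ℝ} (ha : 0 < a) (hb : 0 < b) (hs : 0 < s) :
    Real.Gamma (a + b) / (Real.Gamma a * Real.Gamma b) * (1 + 1 / s) ^ (-(a + b)) / b * s ^ (-b) ≤
      ∫ x in Ioi s, betaPrimeDensity a b x := by
  rw [← integral_const_mul_rpow_Ioi _ hb hs]
  refine setIntegral_mono_on ((integrableOn_Ioi_rpow_of_lt (by linarith) hs).const_mul _)
    ((integrableOn_betaPrimeDensity ha hb).mono_set (Ioi_subset_Ioi hs.le))
    measurableSet_Ioi fun x hx => ?_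
  have hx0 : 0 < x := hs.trans hx
  have ga := Real.Gamma_pos_of_pos ha
  have gb := Real.Gamma_pos_of_pos hb
  have gab := Real.Gamma_pos_of_pos (add_pos ha hb)
  rw [betaPrimeDensity_eq hx0]
  have h : (1 + 1 / s) ^ (-(a + b)) ≤ (1 + 1 / x) ^ (-(a + b)) := by
    refine Real.rpow_le_rpow_of_nonpos (by positivity) ?_ (by linarith)
    gcongr
    exact le_of_lt hx
  gcongr

theorem betaPrime_const_le_of_dominance {a b : ℝ} (ha : 0 < a) (hb : 0 < b)
    (h : ∀ t : ℝ, 0 < t →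
      (∫ x in Ioi (0 : ℝ), ∫ y in Ioi (0 : ℝ),
          (if t < x + y then betaPrimeDensity a b x * betaPrimeDensity a b y else 0))
        ≥ ∫ x in Ioi t, betaPrimeDensity (2 * a) b x) :
    Real.Gamma (2 * a + b) / (Real.Gamma (2 * a) * Real.Gamma b) ≤
      2 * (Real.Gamma (a + b) / (Real.Gamma a * Real.Gamma b)) := by
  set k₂ := Real.Gamma (2 * a + b) / (Real.Gamma (2 * a) * Real.Gamma b) with hk₂
  set k := Real.Gamma (a + b) / (Real.Gamma a * Real.Gamma b) with hk
  have hfin : ∀ ε ∈ Ioo (0 : ℝ) 1, ∀ t : ℝ, 0 < t →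
      k₂ * (1 + 1 / t) ^ (-(2 * a + b)) ≤
        2 * k * (1 - ε) ^ (-b) + k ^ 2 / b * (ε ^ (-b)) ^ 2 * t ^ (-b) := by
    intro ε hε t ht
    have hε0 := hε.1
    have hε1 : 0 < 1 - ε := by linarith [hε.2]
    have hr : 0 < ε * t := by positivity
    have hs : 0 < (1 - ε) * t := by positivity
    have h1 := (le_integral_Ioi_betaPrimeDensity (by positivity : 0 < 2 * a) hb ht).trans (h t ht)
    have h2 := tail_add_le (integrableOn_betaPrimeDensity ha hb)
      (fun x hx => (betaPrimeDensity_pos ha hb hx).le) hr.le hs.le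
      (show ε * t + (1 - ε) * t ≤ t by linarith)
    have h3 := integral_Ioi_betaPrimeDensity_le ha hb hs
    have h4 := pow_le_pow_left₀ (setIntegral_nonneg measurableSet_Ioi fun x hx =>
      (betaPrimeDensity_pos ha hb (hr.trans hx)).le) (integral_Ioi_betaPrimeDensity_le ha hb hr) 2
    rw [Real.mul_rpow hε1.le ht.le] at h3
    rw [Real.mul_rpow hε0.le ht.le] at h4
    rw [integral_betaPrimeDensity ha hb] at h2
    rw [← hk] at h3 h4
    rw [← hk₂] at h1
    have htb : 0 < t ^ (-b) := by positivity
    have h5 : k₂ * (1 + 1 / t) ^ (-(2 * a + b)) / b * t ^ (-b) ≤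
        2 * (k / b * ((1 - ε) ^ (-b) * t ^ (-b))) + (k / b * (ε ^ (-b) * t ^ (-b))) ^ 2 := by
      linarith
    refine le_of_mul_le_mul_right ?_ (div_pos htb hb)
    calc _ = k₂ * (1 + 1 / t) ^ (-(2 * a + b)) / b * t ^ (-b) := by ring
      _ ≤ _ := h5
      _ = _ := by field_simp
  have hlim1 : ∀ ε ∈ Ioo (0 : ℝ) 1, k₂ ≤ 2 * k * (1 - ε) ^ (-b) := by
    intro ε hε
    have l1 : Filter.Tendsto (fun t : ℝ => k₂ * (1 + 1 / t) ^ (-(2 * a + b))) Filter.atTop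
        (nhds (k₂ * (1 + 0) ^ (-(2 * a + b)))) := by
      refine Filter.Tendsto.const_mul _ (Filter.Tendsto.rpow_const ?_ (Or.inl (by norm_num)))
      refine Filter.Tendsto.const_add _ ?_
      exact tendsto_inv_atTop_zero.congr fun t => (one_div t).symm
    have l2 := ((tendsto_rpow_neg_atTop hb).const_mul (k ^ 2 / b * (ε ^ (-b)) ^ 2)).const_add
      (2 * k * (1 - ε) ^ (-b))
    have := le_of_tendsto_of_tendsto l1 l2
      ((Filter.eventually_gt_atTop 0).mono fun t ht => hfin ε hε t ht)
    simpa using this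
  have l3 : Filter.Tendsto (fun ε : ℝ => 2 * k * (1 - ε) ^ (-b)) (nhdsWithin 0 (Ioi 0))
      (nhds (2 * k * (1 - 0) ^ (-b))) := by
    refine Filter.Tendsto.const_mul _ (Filter.Tendsto.rpow_const ?_ (Or.inl (by norm_num)))
    exact Filter.Tendsto.const_sub _ (Filter.tendsto_id.mono_left nhdsWithin_le_nhds)
  have := ge_of_tendsto l3 (Filter.mem_of_superset (Ioo_mem_nhdsGT one_pos) hlim1)
  simpa using this

/-- Proposition: `B'_{a,b} + B'_{a,b}` stochastically dominates `B'_{2a,b}`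
if and only if `b ≤ 1`. -/
theorem betaPrime_conv_stochastic_dominance (a b : ℝ) (ha : 0 < a) (hb : 0 < b) :
    (∀ t : ℝ, 0 < t →
      (∫ x in Ioi (0 : ℝ), ∫ y in Ioi (0 : ℝ),
          (if t < x + y then betaPrimeDensity a b x * betaPrimeDensity a b y else 0))
        ≥ ∫ x in Ioi t, betaPrimeDensity (2 * a) b x)
      ↔ b ≤ 1 := by
  constructor
  · intro h
    by_contra! hb1
    exact absurd (betaPrime_const_le_of_dominance ha hb h)
      (not_le.2 (two_mul_betaPrime_const_lt ha hb1))
  · intro hb1 t ht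
    have h2a : 0 < 2 * a := by positivity
    have hint := integrableOn_betaPrimeDensity h2a hb
    have hsplit : (∫ x in Ioc 0 t, betaPrimeDensity (2 * a) b x) +
        ∫ x in Ioi t, betaPrimeDensity (2 * a) b x = 1 := by
      rw [← integral_betaPrimeDensity h2a hb, ← Ioc_union_Ioi_eq_Ioi ht.le]
      exact (setIntegral_union Ioc_disjoint_Ioi_same measurableSet_Ioi
        (hint.mono_set Ioc_subset_Ioi_self) (hint.mono_set (Ioi_subset_Ioi ht.le))).symm
    have h1 := sq_sub_sq_le_tail_add (t := t) (integrableOn_betaPrimeDensity ha hb)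
      fun x hx => (betaPrimeDensity_pos ha hb hx).le
    have h2 := sq_integral_betaPrimeDensity_le ha hb hb1 ht
    rw [intervalIntegral.integral_of_le ht.le, intervalIntegral.integral_of_le ht.le] at h2
    rw [integral_betaPrimeDensity ha hb] at h1
    linarith
end
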